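/- There exists a bounded plane domain U with Lipschitz boundary that is not convex, but is nevertheless uniquely determined in the class of all plane domains by the condition of local isometry of boundaries in the relative metrics: for every plane domain V, if there exists a bijective local isometry between the Hausdorff boundaries ∂_H U and ∂_H V in their relative metrics, then there exists a Euclidean isometry J: ℝ² → ℝ² with J(U) = V. -/

import Mathlib

open Set Filter Metric Topology ENNReal

noncomputable section

/-- A domain in `ℝⁿ`: a nonempty open connected set. -/
def IsDomainSet {n : ℕ} (U : Set (EuclideanSpace ℝ (Fin n))) : Prop :=
  IsOpen U ∧ IsConnected U

/-- The intrinsic distance inside a set `U`: the infimum of lengths of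
(continuous) paths joining `a` and `b` inside `U`. -/
def intrinsicDist {n : ℕ} (U : Set (EuclideanSpace ℝ (Fin n)))
    (a b : EuclideanSpace ℝ (Fin n)) : ℝ≥0∞ :=
  ⨅ (γ : ℝ → EuclideanSpace ℝ (Fin n)) (_ : ContinuousOn γ (Icc (0:ℝ) 1))
    (_ : γ 0 = a) (_ : γ 1 = b) (_ : ∀ t ∈ Icc (0:ℝ) 1, γ t ∈ U),
    eVariationOn γ (Icc 0 1)

/-- A sequence which is Cauchy with respect to the intrinsic metric `ρ_U`. -/
def IntrinsicCauchy {n : ℕ} (U : Set (EuclideanSpace ℝ (Fin n)))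
    (x : ℕ → EuclideanSpace ℝ (Fin n)) : Prop :=
  ∀ ε : ℝ≥0∞, 0 < ε → ∃ N, ∀ m ≥ N, ∀ k ≥ N, intrinsicDist U (x m) (x k) < ε

/-- An element of the Hausdorff boundary `∂_H U`, represented by a Cauchy
sequence (in the intrinsic metric of `U`) that does not correspond
to a point of `U`. Two such elements with `hDist a b = 0` represent
the same point of `∂_H U`. -/
structure HPoint {n : ℕ} (U : Set (EuclideanSpace ℝ (Fin n))) where
  seq : ℕ → EuclideanSpace ℝ (Fin n)
  mem : ∀ k, seq k ∈ U
  cauchy : IntrinsicCauchy U seq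
  not_inner : ¬ ∃ u ∈ U, Tendsto (fun k => intrinsicDist U (seq k) u) atTop (𝓝 0)

/-- The relative metric `ρ_{∂_H U, U}` on the Hausdorff boundary. -/
def hDist {n : ℕ} {U : Set (EuclideanSpace ℝ (Fin n))} (a b : HPoint U) : ℝ≥0∞ :=
  Filter.liminf (fun k => intrinsicDist U (a.seq k) (b.seq k)) atTop

/-- `f` represents a bijective mapping `∂_H U → ∂_H V` which is a local
isometry in the relative metrics of the Hausdorff boundaries. -/
def HBoundaryLocalIsometry {n : ℕ} {U V : Set (EuclideanSpace ℝ (Fin n))}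
    (f : HPoint U → HPoint V) : Prop :=
  (∀ a b : HPoint U, hDist a b = 0 ↔ hDist (f a) (f b) = 0) ∧
  (∀ b : HPoint V, ∃ a : HPoint U, hDist (f a) b = 0) ∧
  ∀ w : HPoint U, ∃ ε : ℝ≥0∞, 0 < ε ∧ ∀ a b : HPoint U,
    hDist a w < ε → hDist b w < ε → hDist a b = hDist (f a) (f b)

/-- The support of an element of the Hausdorff boundary: the Euclidean limit
of a representing sequence. -/
def hSupport {n : ℕ} {U : Set (EuclideanSpace ℝ (Fin n))} (a : HPoint U) :
    EuclideanSpace ℝ (Fin n) :=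
  limUnder atTop a.seq

/-- `U` has Lipschitz boundary: `∂U` is an `(n-1)`-dimensional Lipschitz
submanifold without boundary, i.e. near each of its points the frontier can be
mapped by a bi-Lipschitz homeomorphism onto an open piece of a hyperplane. -/
def HasLipschitzBoundary {n : ℕ} (U : Set (EuclideanSpace ℝ (Fin n))) : Prop :=
  ∀ x ∈ frontier U, ∃ (W W' : Set (EuclideanSpace ℝ (Fin n)))
    (φ ψ : EuclideanSpace ℝ (Fin n) → EuclideanSpace ℝ (Fin n))
    (K K' : NNReal) (ℓ : EuclideanSpace ℝ (Fin n) →L[ℝ] ℝ),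
    IsOpen W ∧ x ∈ W ∧ IsOpen W' ∧ ℓ ≠ 0 ∧
    LipschitzOnWith K φ W ∧ LipschitzOnWith K' ψ W' ∧
    Set.MapsTo φ W W' ∧ Set.MapsTo ψ W' W ∧
    (∀ z ∈ W, ψ (φ z) = z) ∧ (∀ z ∈ W', φ (ψ z) = z) ∧
    φ '' (W ∩ frontier U) = W' ∩ {y | ℓ y = 0}

section IntrinsicDistance

variable {n : ℕ} {V : Set (EuclideanSpace ℝ (Fin n))} {x y z : EuclideanSpace ℝ (Fin n)}

theorem intrinsicDist_le_eVariationOn {γ : ℝ → EuclideanSpace ℝ (Fin n)} {a b : ℝ} (hab : a ≤ b)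
    (hγ : ContinuousOn γ (Icc a b)) (hV : ∀ t ∈ Icc a b, γ t ∈ V) :
    intrinsicDist V (γ a) (γ b) ≤ eVariationOn γ (Icc a b) := by
  have hmaps : MapsTo (fun t : ℝ => a + t * (b - a)) (Icc 0 1) (Icc a b) := by
    intro t ht
    constructor <;> nlinarith [ht.1, ht.2]
  have hmono : MonotoneOn (fun t : ℝ => a + t * (b - a)) (Icc 0 1) := by
    intro s _ t _ hst
    have := mul_le_mul_of_nonneg_right hst (sub_nonneg.2 hab)
    simpa using this
  refine (iInf₂_le (γ ∘ fun t : ℝ => a + t * (b - a)) ?_).trans ?_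
  · exact hγ.comp (by fun_prop) hmaps
  · refine (iInf₂_le (by simp) (by simp)).trans ((iInf_le _ fun t ht => hV _ (hmaps ht)).trans ?_)
    exact eVariationOn.comp_le_of_monotoneOn γ _ hmono hmaps

theorem exists_path_of_intrinsicDist_lt {c : ℝ≥0∞} (h : intrinsicDist V x y < c) :
    ∃ γ : ℝ → EuclideanSpace ℝ (Fin n), ContinuousOn γ (Icc 0 1) ∧ γ 0 = x ∧ γ 1 = y ∧
      (∀ t ∈ Icc (0 : ℝ) 1, γ t ∈ V) ∧ eVariationOn γ (Icc 0 1) < c := by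
  simp only [intrinsicDist, iInf_lt_iff] at h
  obtain ⟨γ, h1, h2, h3, h4, h5⟩ := h
  exact ⟨γ, h1, h2, h3, h4, h5⟩

theorem edist_le_intrinsicDist : edist x y ≤ intrinsicDist V x y := by
  refine le_iInf fun γ => le_iInf fun _ => le_iInf fun h0 => le_iInf fun h1 => le_iInf fun _ => ?_
  rw [← h0, ← h1]
  exact eVariationOn.edist_le γ (by simp) (by simp)

theorem intrinsicDist_le_edist_of_segment_subset (h : segment ℝ x y ⊆ V) :
    intrinsicDist V x y ≤ edist x y := by
  have h1 := intrinsicDist_le_eVariationOn (V := V) (γ := AffineMap.lineMap x y) zero_le_one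
    (AffineMap.lineMap_continuous.continuousOn) (fun t ht => h (by
      rw [segment_eq_image_lineMap]; exact mem_image_of_mem _ ht))
  rw [AffineMap.lineMap_apply_zero, AffineMap.lineMap_apply_one] at h1
  refine h1.trans ?_
  have h2 := (lipschitzWith_lineMap (𝕜 := ℝ) x y).lipschitzOnWith (s := univ)
    |>.comp_eVariationOn_le (g := fun t : ℝ => t) (s := Icc 0 1) (fun _ _ => mem_univ _)
  refine h2.trans ?_
  have h3 := (monotoneOn_id (s := univ) (α := ℝ)).eVariationOn_eq (mem_univ 0) (mem_univ 1)
  simp only [univ_inter, id, sub_zero, ENNReal.ofReal_one] at h3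
  refine (mul_le_mul_right h3.le _).trans ?_
  rw [mul_one, edist_nndist]

theorem intrinsicDist_eq_edist_of_segment_subset (h : segment ℝ x y ⊆ V) :
    intrinsicDist V x y = edist x y :=
  (intrinsicDist_le_edist_of_segment_subset h).antisymm edist_le_intrinsicDist

theorem intrinsicDist_comm_le : intrinsicDist V x y ≤ intrinsicDist V y x := by
  refine le_of_forall_gt fun c hc => ?_
  obtain ⟨γ, hc, h0, h1, hV, hl⟩ := exists_path_of_intrinsicDist_lt hc
  have hmaps : MapsTo (fun t : ℝ => 1 - t) (Icc 0 1) (Icc 0 1) := by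
    intro t ht
    constructor <;> linarith [ht.1, ht.2]
  have := intrinsicDist_le_eVariationOn (V := V) (γ := γ ∘ fun t : ℝ => 1 - t) zero_le_one
    (hc.comp (by fun_prop) hmaps) (fun t ht => hV _ (hmaps ht))
  simp only [Function.comp_apply, sub_zero, sub_self, h0, h1] at this
  refine (this.trans ?_).trans_lt hl
  exact eVariationOn.comp_le_of_antitoneOn γ _ (fun s _ t _ hst => sub_le_sub_left hst 1) hmaps

theorem intrinsicDist_comm : intrinsicDist V x y = intrinsicDist V y x :=
  intrinsicDist_comm_le.antisymm intrinsicDist_comm_le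

theorem intrinsicDist_triangle :
    intrinsicDist V x z ≤ intrinsicDist V x y + intrinsicDist V y z := by
  refine ENNReal.le_of_forall_pos_le_add fun ε hε hfin => ?_
  have hε' : (ε : ℝ≥0∞) / 2 ≠ 0 := by simpa using hε.ne'
  obtain ⟨γ₁, hc₁, h₁0, h₁1, hV₁, hl₁⟩ := exists_path_of_intrinsicDist_lt
    (ENNReal.lt_add_right (ENNReal.add_lt_top.1 hfin).1.ne hε')
  obtain ⟨γ₂, hc₂, h₂0, h₂1, hV₂, hl₂⟩ := exists_path_of_intrinsicDist_lt
    (ENNReal.lt_add_right (ENNReal.add_lt_top.1 hfin).2.ne hε')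
  set γ : ℝ → EuclideanSpace ℝ (Fin n) := fun t => if t ≤ 1 then γ₁ t else γ₂ (t - 1) with hγ
  have e₁ : EqOn γ γ₁ (Icc 0 1) := fun t ht => if_pos ht.2
  have e₂ : EqOn γ (γ₂ ∘ fun t => t - 1) (Icc 1 2) := by
    intro t ht
    rcases ht.1.eq_or_lt with rfl | h
    · simp [hγ, h₁1, h₂0]
    · simp [hγ, h.not_ge]
  have hmaps : MapsTo (fun t : ℝ => t - 1) (Icc 1 2) (Icc 0 1) := by
    intro t ht
    constructor <;> linarith [ht.1, ht.2]
  have hun : Icc (0 : ℝ) 1 ∪ Icc 1 2 = Icc 0 2 := Icc_union_Icc_eq_Icc zero_le_one one_le_two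
  have hcont : ContinuousOn γ (Icc 0 2) := by
    rw [← hun]
    exact (hc₁.congr e₁).union_of_isClosed ((hc₂.comp (by fun_prop) hmaps).congr e₂)
      isClosed_Icc isClosed_Icc
  have hV : ∀ t ∈ Icc (0 : ℝ) 2, γ t ∈ V := by
    rw [← hun]
    rintro t (ht | ht)
    · rw [e₁ ht]; exact hV₁ t ht
    · rw [e₂ ht]; exact hV₂ _ (hmaps ht)
  have key := intrinsicDist_le_eVariationOn zero_le_two hcont hV
  have hsplit := eVariationOn.Icc_add_Icc γ (s := univ) zero_le_one
    (one_le_two (α := ℝ)) (mem_univ _)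
  simp only [univ_inter] at hsplit
  rw [← hsplit, e₁ (by simp), e₂ (by simp), Function.comp_apply, h₁0,
    show (2 : ℝ) - 1 = 1 by norm_num, h₂1] at key
  refine key.trans ?_
  rw [eVariationOn.congr e₁, eVariationOn.congr e₂]
  have h₂ := eVariationOn.comp_le_of_monotoneOn γ₂ (t := Icc (1 : ℝ) 2) (fun t : ℝ => t - 1)
    (fun s _ t _ hst => sub_le_sub_right hst 1) hmaps
  calc _ ≤ (intrinsicDist V x y + ε / 2) + (intrinsicDist V y z + ε / 2) :=
        add_le_add hl₁.le (h₂.trans hl₂.le)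
    _ = intrinsicDist V x y + intrinsicDist V y z + (ε / 2 + ε / 2) := by ring
    _ = _ := by rw [ENNReal.add_halves]

theorem intrinsicDist_eq_edist_of_mem_ball {r : ℝ} (hV : ball z r ⊆ V) (hx : x ∈ ball z r)
    (hy : y ∈ ball z r) : intrinsicDist V x y = edist x y :=
  intrinsicDist_eq_edist_of_segment_subset (((convex_ball z r).segment_subset hx hy).trans hV)

theorem IsDomainSet.intrinsicDist_ne_top (hV : IsDomainSet V) (hx : x ∈ V) (hy : y ∈ V) :
    intrinsicDist V x y ≠ ∞ := by
  have key : V ⊆ {y | intrinsicDist V x y < ∞} := by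
    have step : ∀ u ∈ V, ∃ r > 0, ball u r ⊆ V ∧ ∀ v ∈ ball u r, intrinsicDist V u v < ∞ := by
      intro u hu
      obtain ⟨r, hr, hball⟩ := Metric.isOpen_iff.1 hV.1 u hu
      refine ⟨r, hr, hball, fun v hv => ?_⟩
      rw [intrinsicDist_eq_edist_of_mem_ball hball (mem_ball_self hr) hv]
      exact edist_lt_top _ _
    have h1 : IsOpen {y | y ∈ V ∧ intrinsicDist V x y < ∞} := by
      refine Metric.isOpen_iff.2 fun u hu => ?_
      obtain ⟨r, hr, hball, h⟩ := step u hu.1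
      exact ⟨r, hr, fun v hv => ⟨hball hv,
        intrinsicDist_triangle.trans_lt (ENNReal.add_lt_top.2 ⟨hu.2, h v hv⟩)⟩⟩
    have h2 : IsOpen {y | y ∈ V ∧ intrinsicDist V x y = ∞} := by
      refine Metric.isOpen_iff.2 fun u hu => ?_
      obtain ⟨r, hr, hball, h⟩ := step u hu.1
      refine ⟨r, hr, fun v hv => ⟨hball hv, ?_⟩⟩
      by_contra hlt
      have h3 := h v hv
      rw [intrinsicDist_comm] at h3
      exact (intrinsicDist_triangle.trans_lt
        (ENNReal.add_lt_top.2 ⟨lt_top_iff_ne_top.2 hlt, h3⟩)).ne hu.2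
    have h3 := hV.2.isPreconnected.subset_left_of_subset_union h1 h2
      (disjoint_left.2 fun u hu hu' => hu.2.ne hu'.2)
      (fun u hu => by
        by_cases h : intrinsicDist V x u = ∞
        exacts [Or.inr ⟨hu, h⟩, Or.inl ⟨hu, lt_top_iff_ne_top.2 h⟩])
    obtain ⟨r, hr, _, h⟩ := step x hx
    exact fun u hu => (h3 ⟨x, hx, hx, h x (mem_ball_self hr)⟩ hu).2
  exact (key hy).ne

end IntrinsicDistance

section IntrinsicCompletion

variable {n : ℕ} {V : Set (EuclideanSpace ℝ (Fin n))}

/-- The points of a domain, endowed with the intrinsic metric. -/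
def IntrinsicSpace (_ : IsDomainSet V) : Type := V

variable {hV : IsDomainSet V}

namespace IntrinsicSpace

/-- The point of `ℝⁿ` underlying a point of the intrinsic space. -/
def val (x : IntrinsicSpace hV) : EuclideanSpace ℝ (Fin n) := Subtype.val x

theorem val_mem (x : IntrinsicSpace hV) : x.val ∈ V := Subtype.property x

/-- A point of a domain, as a point of the intrinsic space. -/
def mk (hV : IsDomainSet V) {x : EuclideanSpace ℝ (Fin n)} (hx : x ∈ V) : IntrinsicSpace hV :=
  ⟨x, hx⟩

@[simp] theorem val_mk {x : EuclideanSpace ℝ (Fin n)} (hx : x ∈ V) : (mk hV hx).val = x := rfl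

theorem val_injective : Function.Injective (val : IntrinsicSpace hV → _) := Subtype.val_injective

theorem intrinsicDist_self {x : EuclideanSpace ℝ (Fin n)} (hx : x ∈ V) :
    intrinsicDist V x x = 0 := by
  rw [intrinsicDist_eq_edist_of_segment_subset (by simpa using hx), edist_self]

instance : MetricSpace (IntrinsicSpace hV) where
  dist x y := (intrinsicDist V x.val y.val).toReal
  dist_self x := by simp [intrinsicDist_self x.val_mem]
  dist_comm x y := by rw [intrinsicDist_comm]
  dist_triangle x y z := by
    rw [← ENNReal.toReal_add (hV.intrinsicDist_ne_top x.val_mem y.val_mem)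
      (hV.intrinsicDist_ne_top y.val_mem z.val_mem)]
    exact ENNReal.toReal_mono (ENNReal.add_ne_top.2
      ⟨hV.intrinsicDist_ne_top x.val_mem y.val_mem, hV.intrinsicDist_ne_top y.val_mem z.val_mem⟩)
      intrinsicDist_triangle
  eq_of_dist_eq_zero {x y} h := by
    refine val_injective (edist_le_zero.1 ((edist_le_intrinsicDist (V := V)).trans (le_of_eq ?_)))
    exact ((ENNReal.toReal_eq_zero_iff _).1 h).resolve_right
      (hV.intrinsicDist_ne_top x.val_mem y.val_mem)

theorem edist_eq (x y : IntrinsicSpace hV) : edist x y = intrinsicDist V x.val y.val := by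
  rw [edist_dist]
  exact ENNReal.ofReal_toReal (hV.intrinsicDist_ne_top x.val_mem y.val_mem)

theorem lipschitzWith_val : LipschitzWith 1 (val : IntrinsicSpace hV → _) := fun x y => by
  rw [edist_eq, ENNReal.coe_one, one_mul]
  exact edist_le_intrinsicDist

theorem dist_eq_of_segment_subset {x y : IntrinsicSpace hV}
    (h : segment ℝ x.val y.val ⊆ V) : dist x y = dist x.val y.val := by
  rw [dist_edist, dist_edist, edist_eq, intrinsicDist_eq_edist_of_segment_subset h]

theorem dist_eq_of_convex {C : Set (EuclideanSpace ℝ (Fin n))} (hC : Convex ℝ C) (hCV : C ⊆ V)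
    {x y : IntrinsicSpace hV} (hx : x.val ∈ C) (hy : y.val ∈ C) : dist x y = dist x.val y.val :=
  dist_eq_of_segment_subset ((hC.segment_subset hx hy).trans hCV)

theorem tendsto_of_tendsto_val {ι : Type*} {l : Filter ι} {u : ι → IntrinsicSpace hV}
    {v : IntrinsicSpace hV} (h : Tendsto (fun i => (u i).val) l (𝓝 v.val)) :
    Tendsto u l (𝓝 v) := by
  obtain ⟨r, hr, hball⟩ := Metric.isOpen_iff.1 hV.1 v.val v.val_mem
  rw [tendsto_iff_dist_tendsto_zero] at h ⊢
  refine h.congr' ?_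
  filter_upwards [h.eventually_lt_const hr] with i hi
  exact (dist_eq_of_convex (convex_ball _ _) hball hi (mem_ball_self hr)).symm

theorem exists_dist_eq_and_dist_lt (x y : IntrinsicSpace hV) {s ε : ℝ} (hs : 0 ≤ s)
    (hs' : s ≤ dist x y) (hε : 0 < ε) :
    ∃ m : IntrinsicSpace hV, dist x m = s ∧ dist m y < dist x y - s + ε := by
  have hlt : intrinsicDist V x.val y.val < intrinsicDist V x.val y.val + ENNReal.ofReal ε :=
    ENNReal.lt_add_right (hV.intrinsicDist_ne_top x.val_mem y.val_mem) (by simpa using hε)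
  obtain ⟨γ, hc, h0, h1, hγV, hl⟩ := exists_path_of_intrinsicDist_lt hlt
  let δ : Icc (0 : ℝ) 1 → IntrinsicSpace hV := fun t => mk hV (hγV t t.2)
  have hδ : Continuous δ := continuous_iff_continuousAt.2 fun t =>
    tendsto_of_tendsto_val (hc.domRestrict.tendsto t)
  have hδ0 : δ ⟨0, by simp⟩ = x := val_injective h0
  have hδ1 : δ ⟨1, by simp⟩ = y := val_injective h1
  obtain ⟨t, ht⟩ := intermediate_value_univ (⟨0, by simp⟩ : Icc (0 : ℝ) 1) ⟨1, by simp⟩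
    (hδ.dist (continuous_const (y := x)))
    (show s ∈ Icc _ _ from ⟨by rw [hδ0, dist_self]; exact hs, by rw [hδ1, dist_comm]; exact hs'⟩)
  replace ht : dist x (δ t) = s := by rw [dist_comm]; exact ht
  refine ⟨δ t, ht, ?_⟩
  have e1 := intrinsicDist_le_eVariationOn t.2.1 (hc.mono (Icc_subset_Icc_right t.2.2))
    (fun u hu => hγV u ⟨hu.1, hu.2.trans t.2.2⟩)
  have e2 := intrinsicDist_le_eVariationOn t.2.2 (hc.mono (Icc_subset_Icc_left t.2.1))
    (fun u hu => hγV u ⟨t.2.1.trans hu.1, hu.2⟩)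
  have hsplit := eVariationOn.Icc_add_Icc γ (s := univ) t.2.1 t.2.2 (mem_univ _)
  simp only [univ_inter] at hsplit
  rw [h0] at e1
  rw [h1] at e2
  have e3 : edist x (δ t) + edist (δ t) y < edist x y + ENNReal.ofReal ε := by
    rw [edist_eq, edist_eq, edist_eq]
    exact (add_le_add e1 e2).trans_lt (hsplit ▸ hl)
  simp only [edist_dist] at e3
  rw [← ENNReal.ofReal_add dist_nonneg dist_nonneg, ← ENNReal.ofReal_add dist_nonneg hε.le,
    ENNReal.ofReal_lt_ofReal_iff_of_nonneg (by positivity), ht] at e3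
  linarith

end IntrinsicSpace

variable (hV) in
/-- The completion of a domain in its intrinsic metric. -/
abbrev IntrinsicCompletion : Type := UniformSpace.Completion (IntrinsicSpace hV)

namespace IntrinsicCompletion

open IntrinsicSpace

/-- The extension of the inclusion of a domain in `ℝⁿ` to the intrinsic completion. -/
def proj : IntrinsicCompletion hV → EuclideanSpace ℝ (Fin n) :=
  UniformSpace.Completion.extension IntrinsicSpace.val

variable (hV) in
/-- The Hausdorff boundary, as a subset of the intrinsic completion. -/
def boundary : Set (IntrinsicCompletion hV) :=
  (range ((↑) : IntrinsicSpace hV → IntrinsicCompletion hV))ᶜ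

@[simp] theorem proj_coe (x : IntrinsicSpace hV) : proj (x : IntrinsicCompletion hV) = x.val :=
  UniformSpace.Completion.extension_coe lipschitzWith_val.uniformContinuous x

theorem lipschitzWith_proj : LipschitzWith 1 (proj : IntrinsicCompletion hV → _) :=
  lipschitzWith_val.completion_extension

theorem continuous_proj : Continuous (proj : IntrinsicCompletion hV → _) :=
  lipschitzWith_proj.continuous

theorem dist_proj_le (y z : IntrinsicCompletion hV) : dist (proj y) (proj z) ≤ dist y z := by
  simpa using lipschitzWith_proj.dist_le_mul y z

theorem exists_seq_tendsto (z : IntrinsicCompletion hV) :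
    ∃ u : ℕ → IntrinsicSpace hV, Tendsto (fun k => (u k : IntrinsicCompletion hV)) atTop (𝓝 z) := by
  obtain ⟨u, hu, hz⟩ := mem_closure_iff_seq_limit.1
    (UniformSpace.Completion.denseRange_coe (α := IntrinsicSpace hV) z)
  choose v hv using hu
  exact ⟨v, by simpa [hv] using hz⟩

theorem proj_notMem {z : IntrinsicCompletion hV} (hz : z ∈ boundary hV) : proj z ∉ V := by
  intro h
  obtain ⟨u, hu⟩ := exists_seq_tendsto z
  have h1 := (continuous_proj.tendsto z).comp hu
  simp only [Function.comp_def, proj_coe] at h1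
  have h2 := ((UniformSpace.Completion.continuous_coe _).tendsto _).comp
    (tendsto_of_tendsto_val (v := mk hV h) h1)
  exact hz ⟨_, tendsto_nhds_unique h2 hu⟩

theorem exists_boundary_limit {C : Set (EuclideanSpace ℝ (Fin n))} (hC : Convex ℝ C) (hCV : C ⊆ V)
    {u : ℕ → IntrinsicSpace hV} (hu : ∀ k, (u k).val ∈ C) {y : EuclideanSpace ℝ (Fin n)}
    (hy : y ∉ V) (huy : Tendsto (fun k => (u k).val) atTop (𝓝 y)) :
    ∃ z ∈ boundary hV, proj z = y ∧
      Tendsto (fun k => (u k : IntrinsicCompletion hV)) atTop (𝓝 z) := by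
  have hcau : CauchySeq fun k => (u k : IntrinsicCompletion hV) := by
    have h := huy.cauchySeq
    rw [Metric.cauchySeq_iff] at h ⊢
    simpa only [UniformSpace.Completion.dist_eq, dist_eq_of_convex hC hCV (hu _) (hu _)] using h
  obtain ⟨z, hz⟩ := cauchySeq_tendsto_of_complete hcau
  have h1 := (continuous_proj.tendsto z).comp hz
  simp only [Function.comp_def, proj_coe] at h1
  have hzy := tendsto_nhds_unique h1 huy
  refine ⟨z, ?_, hzy, hz⟩
  rintro ⟨x, rfl⟩
  rw [proj_coe] at hzy
  exact hy (hzy ▸ x.val_mem)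

theorem exists_boundary_dist_le (hne : Vᶜ.Nonempty) (x : IntrinsicSpace hV) :
    ∃ z ∈ boundary hV, dist (x : IntrinsicCompletion hV) z ≤ infDist x.val Vᶜ := by
  obtain ⟨y, hy, hxy⟩ := hV.1.isClosed_compl.exists_infDist_eq_dist hne x.val
  have hball : ball x.val (dist x.val y) ⊆ V := by
    rw [← hxy, ← disjoint_compl_right_iff_subset]; exact disjoint_ball_infDist
  have hpos : 0 < dist x.val y := dist_pos.2 fun h => hy (h ▸ x.val_mem)
  have hmem : ∀ k : ℕ, AffineMap.lineMap y x.val (1 / ((k : ℝ) + 1)) ∈ ball x.val (dist x.val y) := by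
    intro k
    rw [mem_ball, dist_lineMap_right, dist_comm y]
    have : 0 < 1 / ((k : ℝ) + 1) := by positivity
    have h1 : 1 / ((k : ℝ) + 1) ≤ 1 := by
      rw [div_le_one (by positivity)]; linarith [(Nat.cast_nonneg k : (0:ℝ) ≤ k)]
    rw [Real.norm_of_nonneg (by linarith)]
    nlinarith
  have htend : Tendsto (fun k : ℕ => AffineMap.lineMap y x.val (1 / ((k : ℝ) + 1))) atTop (𝓝 y) := by
    have := (AffineMap.lineMap_continuous (p := y) (q := x.val)).tendsto (0 : ℝ)
    rw [AffineMap.lineMap_apply_zero] at this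
    exact this.comp tendsto_one_div_add_atTop_nhds_zero_nat
  obtain ⟨z, hz, -, hlim⟩ := exists_boundary_limit (hV := hV) (convex_ball _ _) hball
    (u := fun k => mk hV (hball (hmem k))) hmem hy htend
  have hd : ∀ k : ℕ, dist (x : IntrinsicCompletion hV) (mk hV (hball (hmem k)) : IntrinsicSpace hV) ≤
      infDist x.val Vᶜ := by
    intro k
    have hk : (mk hV (hball (hmem k))).val ∈ ball x.val (dist x.val y) := hmem k
    rw [UniformSpace.Completion.dist_eq,
      dist_eq_of_convex (convex_ball _ _) hball (mem_ball_self hpos) hk, hxy, dist_comm]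
    exact hk.le
  exact ⟨z, hz, le_of_tendsto ((tendsto_const_nhds (x := (x : IntrinsicCompletion hV))).dist hlim)
    (.of_forall hd)⟩

theorem exists_dist_lt_and_dist_lt (y z : IntrinsicCompletion hV) {s ε : ℝ} (hs : 0 ≤ s)
    (hs' : s ≤ dist y z) (hε : 0 < ε) :
    ∃ m : IntrinsicSpace hV, dist y m < s + ε ∧ dist (m : IntrinsicCompletion hV) z < dist y z - s + ε := by
  obtain ⟨a, ha⟩ := UniformSpace.Completion.denseRange_coe.exists_dist_lt y
    (show 0 < ε / 8 by positivity)
  obtain ⟨b, hb⟩ := UniformSpace.Completion.denseRange_coe.exists_dist_lt z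
    (show 0 < ε / 8 by positivity)
  obtain ⟨m, hm, hm'⟩ := exists_dist_eq_and_dist_lt a b (s := min s (dist a b)) (ε := ε / 8)
    (le_min hs dist_nonneg) (min_le_right _ _) (by positivity)
  rw [← UniformSpace.Completion.dist_eq a m] at hm
  rw [← UniformSpace.Completion.dist_eq a b] at hm
  rw [← UniformSpace.Completion.dist_eq m b, ← UniformSpace.Completion.dist_eq a b] at hm'
  have h1 := dist_triangle y a m
  have h2 := dist_triangle_right (m : IntrinsicCompletion hV) z b
  have h3 := dist_triangle4 y a b z
  have h4 := dist_triangle4 (a : IntrinsicCompletion hV) y z b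
  rw [dist_comm (b : IntrinsicCompletion hV) z] at h3
  rw [dist_comm (a : IntrinsicCompletion hV) y] at h4
  have h5 := min_le_left s (dist (a : IntrinsicCompletion hV) b)
  have h6 : s - ε / 4 ≤ min s (dist (a : IntrinsicCompletion hV) b) :=
    le_min (by linarith) (by linarith)
  exact ⟨m, by linarith, by linarith⟩

end IntrinsicCompletion

end IntrinsicCompletion

section Geodesics

open IntrinsicSpace IntrinsicCompletion

variable {n : ℕ} {V : Set (EuclideanSpace ℝ (Fin n))} {hV : IsDomainSet V}

theorem IntrinsicCompletion.exists_tendsto_subseq (hc : IsCompact (boundary hV))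
    (hne : Vᶜ.Nonempty) {y : IntrinsicCompletion hV} {R : ℝ} {u : ℕ → IntrinsicSpace hV}
    (hu : ∀ k, dist y (u k : IntrinsicCompletion hV) ≤ R) :
    ∃ (z : IntrinsicCompletion hV) (φ : ℕ → ℕ), StrictMono φ ∧
      Tendsto (fun k => (u (φ k) : IntrinsicCompletion hV)) atTop (𝓝 z) := by
  have hmem : ∀ k, (u k).val ∈ closedBall (proj y) R := fun k => by
    rw [mem_closedBall']
    have := (dist_proj_le y (u k)).trans (hu k)
    rwa [proj_coe] at this
  obtain ⟨μ, -, φ, hφ, hμ⟩ := (isCompact_closedBall (proj y) R).tendsto_subseq hmem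
  by_cases hμV : μ ∈ V
  · exact ⟨(mk hV hμV : IntrinsicSpace hV), φ, hφ,
      ((UniformSpace.Completion.continuous_coe _).tendsto _).comp
        (tendsto_of_tendsto_val (v := mk hV hμV) hμ)⟩
  · choose z hz hzd using fun k => exists_boundary_dist_le hne (u (φ k))
    obtain ⟨ζ, -, ψ, hψ, hζ⟩ := hc.tendsto_subseq hz
    refine ⟨ζ, φ ∘ ψ, hφ.comp hψ, ?_⟩
    have h0 : Tendsto (fun k => dist (z (ψ k)) (u (φ (ψ k)) : IntrinsicCompletion hV)) atTop (𝓝 0) := by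
      refine squeeze_zero (fun _ => dist_nonneg) (fun k => ?_)
        ((tendsto_iff_dist_tendsto_zero.1 hμ).comp hψ.tendsto_atTop)
      rw [dist_comm]
      exact (hzd _).trans (infDist_le_dist_of_mem hμV)
    exact (tendsto_iff_of_dist h0).1 hζ

theorem IntrinsicCompletion.exists_dist_eq_and_dist_eq (hc : IsCompact (boundary hV))
    (hne : Vᶜ.Nonempty) (y z : IntrinsicCompletion hV) {s : ℝ} (hs : 0 ≤ s) (hs' : s ≤ dist y z) :
    ∃ m : IntrinsicCompletion hV, dist y m = s ∧ dist m z = dist y z - s := by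
  choose u hu hu' using fun k : ℕ => exists_dist_lt_and_dist_lt y z hs hs'
    (Nat.one_div_pos_of_nat (α := ℝ) (n := k))
  have hone : ∀ k : ℕ, 1 / ((k : ℝ) + 1) ≤ 1 := fun k => by
    rw [div_le_one (by positivity)]; linarith [(Nat.cast_nonneg k : (0 : ℝ) ≤ k)]
  obtain ⟨m, φ, hφ, hm⟩ := exists_tendsto_subseq hc hne
    (fun k => (hu k).le.trans (add_le_add_right (hone k) s))
  have hε : Tendsto (fun k : ℕ => 1 / ((φ k : ℝ) + 1)) atTop (𝓝 0) :=
    tendsto_one_div_add_atTop_nhds_zero_nat.comp hφ.tendsto_atTop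
  have h1 := le_of_tendsto_of_tendsto' ((tendsto_const_nhds (x := y)).dist hm) (hε.const_add s)
    (fun k => (hu (φ k)).le)
  have h2 := le_of_tendsto_of_tendsto' (hm.dist (tendsto_const_nhds (x := z)))
    (hε.const_add (dist y z - s)) (fun k => (hu' (φ k)).le)
  have h3 := dist_triangle y m z
  exact ⟨m, by linarith, by linarith⟩

variable {p q : IntrinsicCompletion hV}

theorem IntrinsicCompletion.exists_next (hc : IsCompact (boundary hV)) (hne : Vᶜ.Nonempty)
    (hbd : ∀ z ∈ boundary hV, dist p z + dist z q = dist p q → z = p ∨ z = q)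
    {x : IntrinsicCompletion hV} (hx : dist p x + dist x q = dist p q) {h : ℝ} (hpos : 0 < h)
    (hlt : h < dist x q) :
    ∃ y : IntrinsicSpace hV, dist x y = h ∧ dist p y = dist p x + h ∧
      dist (y : IntrinsicCompletion hV) q = dist x q - h := by
  obtain ⟨m, hm, hm'⟩ := exists_dist_eq_and_dist_eq hc hne x q hpos.le hlt.le
  have h1 := dist_triangle p x m
  have h2 := dist_triangle p m q
  have hpm : dist p m = dist p x + h := by linarith
  have : m ∉ boundary hV := by
    intro hmb
    rcases hbd m hmb (by linarith) with rfl | rfl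
    · rw [dist_self] at hpm; linarith [dist_nonneg (x := m) (y := x)]
    · rw [dist_self] at hm'; linarith
  obtain ⟨y, rfl⟩ := not_not.1 this
  exact ⟨y, hm, hpm, hm'⟩

theorem IntrinsicCompletion.exists_le_infDist (hc : IsCompact (boundary hV)) (hne : Vᶜ.Nonempty)
    (hbd : ∀ z ∈ boundary hV, dist p z + dist z q = dist p q → z = p ∨ z = q)
    {δ : ℝ} (hδ : 0 < δ) :
    ∃ c > 0, ∀ x : IntrinsicSpace hV, dist p x + dist (x : IntrinsicCompletion hV) q = dist p q →
      δ ≤ dist p x → δ ≤ dist (x : IntrinsicCompletion hV) q → c ≤ infDist x.val Vᶜ := by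
  by_contra! hcon
  choose u hu hup huq hud using fun k : ℕ => hcon _ (Nat.one_div_pos_of_nat (α := ℝ) (n := k))
  obtain ⟨z, φ, hφ, hz⟩ := exists_tendsto_subseq hc hne (y := p) (R := dist p q) (u := u)
    (fun k => by linarith [hu k, dist_nonneg (x := (u k : IntrinsicCompletion hV)) (y := q)])
  have hpz := (tendsto_const_nhds (x := p)).dist hz
  have hzq := hz.dist (tendsto_const_nhds (x := q))
  have e1 := tendsto_nhds_unique (hpz.add hzq)
    (tendsto_const_nhds.congr fun k => (hu (φ k)).symm)
  have e2 : δ ≤ dist p z := ge_of_tendsto' hpz fun k => hup (φ k)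
  have e3 : δ ≤ dist z q := ge_of_tendsto' hzq fun k => huq (φ k)
  have e4 : infDist (proj z) Vᶜ ≤ 0 := by
    have h1 := ((continuous_infDist_pt Vᶜ).comp continuous_proj).tendsto z |>.comp hz
    refine le_of_tendsto_of_tendsto' h1
      (tendsto_one_div_add_atTop_nhds_zero_nat.comp hφ.tendsto_atTop) fun k => ?_
    simpa using (hud (φ k)).le
  have e5 : proj z ∈ Vᶜ := (hV.1.isClosed_compl.mem_iff_infDist_zero hne).2
    (le_antisymm e4 infDist_nonneg)
  have hzb : z ∈ boundary hV := by
    rintro ⟨x, rfl⟩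
    exact e5 (by simpa using x.val_mem)
  rcases hbd z hzb e1 with rfl | rfl
  · rw [dist_self] at e2; linarith
  · rw [dist_self] at e3; linarith

theorem IntrinsicSpace.dist_eq_of_lt_infDist {x a b : IntrinsicSpace hV} {c : ℝ}
    (hx : c ≤ infDist x.val Vᶜ) (ha : dist x a < c) (hb : dist x b < c) :
    dist a b = dist a.val b.val := by
  have hball : ball x.val c ⊆ V := by
    rw [← disjoint_compl_right_iff_subset]
    exact disjoint_ball_infDist.mono_left (ball_subset_ball hx)
  have hmem : ∀ a : IntrinsicSpace hV, dist x a < c → a.val ∈ ball x.val c := fun a ha => by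
    rw [mem_ball']
    simpa using (lipschitzWith_val.dist_le_mul x a).trans_lt (by simpa using ha)
  exact dist_eq_of_convex (convex_ball _ _) hball (hmem a ha) (hmem b hb)

theorem IntrinsicCompletion.le_dist_proj (hc : IsCompact (boundary hV)) (hne : Vᶜ.Nonempty)
    (hbd : ∀ z ∈ boundary hV, dist p z + dist z q = dist p q → z = p ∨ z = q)
    {δ : ℝ} (hδ : 0 < δ) (hδ' : 2 * δ < dist p q) :
    dist p q - 4 * δ ≤ dist (proj p) (proj q) := by
  obtain ⟨c, hcpos, hcd⟩ := exists_le_infDist hc hne hbd hδ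
  obtain ⟨N, hN⟩ := exists_nat_gt ((dist p q - 2 * δ) / c)
  have hNpos : (0 : ℝ) < N := (div_pos (by linarith) hcpos).trans hN
  set h := (dist p q - 2 * δ) / N with hdef
  have hpos : 0 < h := div_pos (by linarith) hNpos
  have hNh : N * h = dist p q - 2 * δ := by rw [hdef]; field_simp
  have hhc : h < c := by
    rw [div_lt_iff₀ hcpos] at hN
    rw [hdef, div_lt_iff₀ hNpos]; linarith
  obtain ⟨x₀, hx₀, hpx₀, hqx₀⟩ := exists_next hc hne hbd (x := p) (by simp) hδ (by linarith)
  have hchain : ∀ k : ℕ, k < N → ∃ x x' : IntrinsicSpace hV,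
      dist p x + dist (x : IntrinsicCompletion hV) q = dist p q ∧ dist p x = δ + k * h ∧
      dist p x' + dist (x' : IntrinsicCompletion hV) q = dist p q ∧ dist p x' = δ + (k + 1) * h ∧
      dist x x' = h ∧ x'.val - x₀.val = ((k : ℝ) + 1) • (x'.val - x.val) := by
    intro k
    induction k with
    | zero =>
      intro hk
      have : (1 : ℝ) ≤ N := by exact_mod_cast hk
      obtain ⟨x', e1, e2, e3⟩ := exists_next hc hne hbd (x := x₀) (by linarith) hpos (by nlinarith)
      rw [UniformSpace.Completion.dist_eq] at e1
      exact ⟨x₀, x', by linarith, by simpa using hx₀, by linarith, by simp; linarith, e1, by simp⟩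
    | succ k ih =>
      intro hk
      obtain ⟨x, x', h1, h2, h3, h4, h5, h6⟩ := ih (by omega)
      have hkN : (k : ℝ) + 2 ≤ N := by exact_mod_cast hk
      have hkN' : ((k : ℝ) + 2) * h ≤ N * h := mul_le_mul_of_nonneg_right hkN hpos.le
      obtain ⟨x'', e1, e2, e3⟩ := exists_next hc hne hbd h3 hpos (by linarith)
      have hk0 : 0 ≤ k * h := by positivity
      have hinf := hcd x' h3 (by linarith) (by linarith)
      rw [UniformSpace.Completion.dist_eq] at e1
      have t1 := dist_triangle p (x : IntrinsicCompletion hV) x''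
      have t2 := dist_triangle x x' x''
      rw [UniformSpace.Completion.dist_eq] at t1
      have f1 := dist_eq_of_lt_infDist hinf (a := x) (b := x') (by rw [dist_comm]; linarith)
        (by simpa using hcpos)
      have f2 := dist_eq_of_lt_infDist hinf (a := x') (b := x'') (by simpa using hcpos)
        (by linarith)
      have f3 := dist_eq_of_lt_infDist hinf (a := x) (b := x'') (by rw [dist_comm]; linarith)
        (by linarith)
      have f4 : x'.val - x.val = x''.val - x'.val := by
        rw [dist_eq_norm'] at f1 f2 f3
        refine eq_of_norm_eq_of_norm_add_eq (by linarith) ?_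
        rw [sub_add_sub_cancel']
        linarith
      refine ⟨x', x'', h3, by push_cast; linarith, by linarith, by push_cast; linarith, e1, ?_⟩
      rw [← sub_add_sub_cancel _ x'.val, h6, ← f4]
      push_cast
      module
  obtain ⟨x, x', h1, h2, h3, h4, h5, h6⟩ := hchain (N - 1) (by
    have : 0 < N := by exact_mod_cast hNpos
    omega)
  have hN1 : ((N - 1 : ℕ) : ℝ) + 1 = N := by
    have : 0 < N := by exact_mod_cast hNpos
    norm_cast; omega
  rw [hN1] at h4 h6
  have hNk : ((N - 1 : ℕ) : ℝ) * h = N * h - h := by rw [← hN1]; ring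
  have hinf : c ≤ infDist x'.val Vᶜ := hcd x' h3 (by linarith) (by linarith)
  have f1 := dist_eq_of_lt_infDist hinf (a := x) (b := x') (by rw [dist_comm]; linarith)
        (by simpa using hcpos)
  have f2 : dist x'.val x₀.val = dist p q - 2 * δ := by
    rw [dist_eq_norm, h6, norm_smul, ← dist_eq_norm', ← f1, h5, Real.norm_of_nonneg hNpos.le, hNh]
  have g1 := dist_proj_le p x₀
  have g2 := dist_proj_le (x' : IntrinsicCompletion hV) q
  rw [proj_coe] at g1 g2
  have g3 := dist_triangle4_left x'.val x₀.val (proj q) (proj p)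
  have g4 := dist_triangle4 x'.val (proj q) (proj p) x₀.val
  rw [dist_comm (proj q)] at g4
  linarith

theorem IntrinsicCompletion.dist_proj_eq (hc : IsCompact (boundary hV)) (hne : Vᶜ.Nonempty)
    (hbd : ∀ z ∈ boundary hV, dist p z + dist z q = dist p q → z = p ∨ z = q) :
    dist (proj p) (proj q) = dist p q := by
  refine le_antisymm (dist_proj_le p q) ?_
  by_contra! hlt
  have hpq : 0 < dist p q := dist_nonneg.trans_lt hlt
  have := le_dist_proj hc hne hbd (δ := (dist p q - dist (proj p) (proj q)) / 8) (by linarith)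
    (by linarith [dist_nonneg (x := proj p) (y := proj q)])
  linarith

theorem IntrinsicCompletion.midpoint_proj_mem (hc : IsCompact (boundary hV)) (hne : Vᶜ.Nonempty)
    (hbd : ∀ z ∈ boundary hV, dist p z + dist z q = dist p q → z = p ∨ z = q) (hpq : p ≠ q) :
    midpoint ℝ (proj p) (proj q) ∈ V := by
  have hpos : 0 < dist p q := dist_pos.2 hpq
  obtain ⟨m, -, h1, h2⟩ := exists_next hc hne hbd (x := p) (by simp) (half_pos hpos)
    (half_lt_self hpos)
  have h3 := dist_proj_eq hc hne hbd
  have g1 := dist_proj_le p m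
  have g2 := dist_proj_le (m : IntrinsicCompletion hV) q
  rw [dist_self] at h1
  rw [proj_coe] at g1 g2
  have g3 := dist_triangle (proj p) m.val (proj q)
  have : m.val = midpoint ℝ (proj p) (proj q) :=
    eq_midpoint_of_dist_eq_half (by linarith) (by linarith)
  rw [← this]
  exact m.val_mem

end Geodesics

section BoundaryPoints

open IntrinsicSpace IntrinsicCompletion

variable {n : ℕ} {V : Set (EuclideanSpace ℝ (Fin n))} (hV : IsDomainSet V)

theorem HPoint.exists_mem_boundary (a : HPoint V) :
    ∃ z ∈ boundary hV,
      Tendsto (fun k => (IntrinsicSpace.mk hV (a.mem k) : IntrinsicCompletion hV)) atTop (𝓝 z) := by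
  have hcau : CauchySeq fun k => (IntrinsicSpace.mk hV (a.mem k) : IntrinsicCompletion hV) := by
    refine EMetric.cauchySeq_iff.2 fun ε hε => ?_
    obtain ⟨N, hN⟩ := a.cauchy ε hε
    refine ⟨N, fun m hm k hk => ?_⟩
    rw [UniformSpace.Completion.edist_eq, edist_eq]
    exact hN m hm k hk
  obtain ⟨z, hz⟩ := cauchySeq_tendsto_of_complete hcau
  refine ⟨z, ?_, hz⟩
  rintro ⟨x, rfl⟩
  refine a.not_inner ⟨x.val, x.val_mem, ?_⟩
  have := tendsto_iff_edist_tendsto_0.1 hz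
  simpa only [UniformSpace.Completion.edist_eq, edist_eq, val_mk] using this

/-- The point of the intrinsic completion represented by an element of the Hausdorff boundary. -/
def HPoint.limit (a : HPoint V) : IntrinsicCompletion hV := (a.exists_mem_boundary hV).choose

theorem HPoint.limit_mem (a : HPoint V) : a.limit hV ∈ boundary hV :=
  (a.exists_mem_boundary hV).choose_spec.1

theorem HPoint.tendsto_limit (a : HPoint V) :
    Tendsto (fun k => (IntrinsicSpace.mk hV (a.mem k) : IntrinsicCompletion hV)) atTop (𝓝 (a.limit hV)) :=
  (a.exists_mem_boundary hV).choose_spec.2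

theorem hDist_eq_edist_limit (a b : HPoint V) : hDist a b = edist (a.limit hV) (b.limit hV) := by
  have := (a.tendsto_limit hV).edist (b.tendsto_limit hV)
  simp only [UniformSpace.Completion.edist_eq, edist_eq, val_mk] at this
  exact this.liminf_eq

theorem exists_hPoint_limit_eq {z : IntrinsicCompletion hV} (hz : z ∈ boundary hV) :
    ∃ a : HPoint V, a.limit hV = z := by
  obtain ⟨u, hu⟩ := exists_seq_tendsto z
  have hcau : IntrinsicCauchy V fun k => (u k).val := by
    intro ε hε
    obtain ⟨N, hN⟩ := EMetric.cauchySeq_iff.1 hu.cauchySeq ε hε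
    refine ⟨N, fun m hm k hk => ?_⟩
    rw [← edist_eq, ← UniformSpace.Completion.edist_eq]
    exact hN m hm k hk
  refine ⟨⟨fun k => (u k).val, fun k => (u k).val_mem, hcau, ?_⟩, ?_⟩
  · rintro ⟨x, hx, h⟩
    have h' : Tendsto (fun k => edist (u k : IntrinsicCompletion hV) (mk hV hx : IntrinsicSpace hV))
        atTop (𝓝 0) := by
      simpa only [UniformSpace.Completion.edist_eq, edist_eq, val_mk] using h
    exact hz ⟨_, tendsto_nhds_unique (tendsto_iff_edist_tendsto_0.2 h') hu⟩
  · exact tendsto_nhds_unique (HPoint.tendsto_limit hV _) hu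

variable {U : Set (EuclideanSpace ℝ (Fin n))} (hU : IsDomainSet U)

/-- A local isometry of Hausdorff boundaries, as a map between the boundaries in the intrinsic
completions. -/
theorem HBoundaryLocalIsometry.exists_boundary_map {f : HPoint U → HPoint V}
    (hf : HBoundaryLocalIsometry f) :
    ∃ g : boundary hU → IntrinsicCompletion hV, Function.Injective g ∧ range g = boundary hV ∧
      ∀ w : boundary hU, ∃ ε > 0, ∀ a b : boundary hU,
        dist a w < ε → dist b w < ε → dist (g a) (g b) = dist a b := by
  choose r hr using fun z : boundary hU => exists_hPoint_limit_eq hU z.2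
  have hDr : ∀ a b, hDist (r a) (r b) = edist a b := fun a b => by
    rw [hDist_eq_edist_limit hU, hr, hr, Subtype.edist_eq]
  refine ⟨fun z => (f (r z)).limit hV, fun a b hab => ?_, ?_, fun w => ?_⟩
  · have : hDist (f (r a)) (f (r b)) = 0 := by
      rw [hDist_eq_edist_limit hV, edist_eq_zero]; exact hab
    rwa [← hf.1, hDr, edist_eq_zero] at this
  · refine Subset.antisymm (range_subset_iff.2 fun z => HPoint.limit_mem hV _) fun z hz => ?_
    obtain ⟨b, rfl⟩ := exists_hPoint_limit_eq hV hz
    obtain ⟨a, ha⟩ := hf.2.1 b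
    refine ⟨⟨a.limit hU, a.limit_mem hU⟩, ?_⟩
    have h1 : hDist (r ⟨a.limit hU, a.limit_mem hU⟩) a = 0 := by
      rw [hDist_eq_edist_limit hU, hr, edist_self]
    rw [hf.1, hDist_eq_edist_limit hV, edist_eq_zero] at h1
    rw [hDist_eq_edist_limit hV, edist_eq_zero] at ha
    exact h1.trans ha
  · obtain ⟨ε, hε, h⟩ := hf.2.2 (r w)
    obtain ⟨δ, hδ, hδε⟩ := ENNReal.lt_iff_exists_nnreal_btwn.1 hε
    have hlt : ∀ a, dist a w < δ → hDist (r a) (r w) < ε := fun a ha => by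
      rw [hDr, edist_nndist]
      exact (ENNReal.coe_lt_coe.2 (by exact_mod_cast ha)).trans hδε
    refine ⟨δ, by exact_mod_cast hδ, fun a b ha hb => ?_⟩
    have := h (r a) (r b) (hlt a ha) (hlt b hb)
    rw [hDr, hDist_eq_edist_limit hV] at this
    rw [dist_edist, dist_edist, this]

end BoundaryPoints

section IsometryExtension

variable {E : Type*} [NormedAddCommGroup E] [InnerProductSpace ℝ E]

theorem AffineIsometryEquiv.ext_of_eqOn {S : Set E} {J J' : E ≃ᵃⁱ[ℝ] E}
    (hS : affineSpan ℝ S = ⊤) (h : EqOn J J' S) : J = J' := by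
  ext x
  have hx : x ∈ affineSpan ℝ S := hS ▸ AffineSubspace.mem_top ℝ E x
  refine affineSpan_induction hx h fun c u v w hu hv hw => ?_
  rw [J.map_vadd, J'.map_vadd, map_smul, map_smul, J.map_vsub, J'.map_vsub, hu, hv, hw]

variable [FiniteDimensional ℝ E]

theorem exists_linearIsometryEquiv_of_inner_eq {ι : Type*} {v w : ι → E}
    (h : ∀ i j, inner ℝ (v i) (v j) = inner ℝ (w i) (w j)) :
    ∃ L : E ≃ₗᵢ[ℝ] E, ∀ i, L (v i) = w i := by
  let T := Finsupp.linearCombination ℝ v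
  let T' := Finsupp.linearCombination ℝ w
  have hin : ∀ c : ι →₀ ℝ, ‖T c‖ = ‖T' c‖ := fun c => by
    have : inner ℝ (T c) (T c) = inner ℝ (T' c) (T' c) := by
      simp only [T, T', Finsupp.linearCombination_apply, Finsupp.sum, sum_inner, inner_sum,
        inner_smul_left, inner_smul_right, h]
    rw [real_inner_self_eq_norm_sq, real_inner_self_eq_norm_sq] at this
    exact (sq_eq_sq₀ (norm_nonneg _) (norm_nonneg _)).1 this
  have hker : LinearMap.ker T ≤ LinearMap.ker T' := fun c hc => by
    rw [LinearMap.mem_ker] at hc ⊢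
    rw [← norm_eq_zero, ← hin, hc, norm_zero]
  let M : LinearMap.range T →ₗ[ℝ] E :=
    (LinearMap.ker T).liftQ T' hker ∘ₗ T.quotKerEquivRange.symm.toLinearMap
  have hM : ∀ c, M ⟨T c, LinearMap.mem_range_self T c⟩ = T' c := fun c => by
    have : T.quotKerEquivRange.symm ⟨T c, LinearMap.mem_range_self T c⟩
        = (LinearMap.ker T).mkQ c := by
      rw [LinearEquiv.symm_apply_eq]; rfl
    simp only [M, LinearMap.comp_apply, LinearEquiv.coe_coe, this]
    rfl
  let Li : LinearMap.range T →ₗᵢ[ℝ] E :=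
    ⟨M, by rintro ⟨_, c, rfl⟩; rw [hM]; exact (hin c).symm⟩
  refine ⟨Li.extend.toLinearIsometryEquiv rfl, fun i => ?_⟩
  have hv : T (Finsupp.single i 1) = v i := by simp [T]
  have hw : T' (Finsupp.single i 1) = w i := by simp [T']
  rw [LinearIsometry.coe_toLinearIsometryEquiv, ← hv, ← hw, ← hM]
  exact LinearIsometry.extend_apply Li ⟨_, LinearMap.mem_range_self T _⟩

theorem exists_affineIsometryEquiv_of_dist_eq {S : Set E} {f : E → E}
    (h : ∀ a ∈ S, ∀ b ∈ S, dist (f a) (f b) = dist a b) :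
    ∃ J : E ≃ᵃⁱ[ℝ] E, EqOn J f S := by
  rcases S.eq_empty_or_nonempty with rfl | ⟨p, hp⟩
  · exact ⟨.refl ℝ E, fun _ => False.elim⟩
  obtain ⟨L, hL⟩ := exists_linearIsometryEquiv_of_inner_eq (ι := S) (v := fun a => a.1 - p)
    (w := fun a => f a - f p) fun a b => by
      rw [real_inner_eq_norm_mul_self_add_norm_mul_self_sub_norm_sub_mul_self_div_two,
        real_inner_eq_norm_mul_self_add_norm_mul_self_sub_norm_sub_mul_self_div_two,
        sub_sub_sub_cancel_right, sub_sub_sub_cancel_right]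
      simp only [← dist_eq_norm, h _ a.2 _ b.2, h _ a.2 _ hp, h _ b.2 _ hp]
  refine ⟨AffineIsometryEquiv.mk' (fun x => L (x - p) + f p) L p fun x => by simp, fun a ha => ?_⟩
  simpa using congrArg (· + f p) (hL ⟨a, ha⟩)

/-- A map which is locally an isometry on a connected set, all of whose relatively open parts
span the whole space, is the restriction of a global isometry. -/
theorem exists_affineIsometryEquiv_of_locally_dist_eq {S : Set E} (hS : IsPreconnected S)
    {f : E → E} (hspan : ∀ w ∈ S, ∀ ε > 0, affineSpan ℝ (S ∩ ball w ε) = ⊤)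
    (h : ∀ w ∈ S, ∃ ε > 0, ∀ a ∈ S ∩ ball w ε, ∀ b ∈ S ∩ ball w ε,
      dist (f a) (f b) = dist a b) :
    ∃ J : E ≃ᵃⁱ[ℝ] E, EqOn J f S := by
  choose! ε hε h using h
  have hJ : ∀ w ∈ S, ∃ J : E ≃ᵃⁱ[ℝ] E, EqOn J f (S ∩ ball w (ε w)) := fun w hw =>
    exists_affineIsometryEquiv_of_dist_eq (h w hw)
  choose! J hJ using hJ
  rcases S.eq_empty_or_nonempty with rfl | ⟨p, hp⟩
  · exact ⟨.refl ℝ E, fun _ => False.elim⟩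
  have : PreconnectedSpace S := isPreconnected_iff_preconnectedSpace.1 hS
  have hloc : IsLocallyConstant fun w : S => J w := by
    rw [IsLocallyConstant.iff_exists_open]
    refine fun w => ⟨{x | x.1 ∈ ball w.1 (ε w)}, isOpen_ball.preimage continuous_subtype_val,
      mem_ball_self (hε w w.2), fun x hx => ?_⟩
    obtain ⟨δ, hδ, hδw⟩ := Metric.isOpen_iff.1 (isOpen_ball (x := w.1) (ε := ε w)) x.1 hx
    refine AffineIsometryEquiv.ext_of_eqOn
      (hspan x x.2 (min δ (ε x)) (lt_min hδ (hε x x.2))) fun y hy => ?_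
    rw [hJ x x.2 ⟨hy.1, ball_subset_ball (min_le_right _ _) hy.2⟩,
      hJ w w.2 ⟨hy.1, hδw (ball_subset_ball (min_le_left _ _) hy.2)⟩]
  refine ⟨J p, fun w hw => ?_⟩
  rw [show J p = J w from hloc.apply_eq_of_preconnectedSpace ⟨p, hp⟩ ⟨w, hw⟩]
  exact hJ w hw ⟨hw, mem_ball_self (hε w hw)⟩

theorem affineSpan_inter_ball_eq_top (hE : Module.finrank ℝ E = 2) {S : Set E}
    (hS : Preperfect S) {w : E} (hw : w ∈ S) {ε : ℝ} (hε : 0 < ε)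
    (h : ∀ a ∈ S ∩ ball w ε, ∀ b ∈ S ∩ ball w ε, a ≠ b → Disjoint (openSegment ℝ a b) S) :
    affineSpan ℝ (S ∩ ball w ε) = ⊤ := by
  have hsep : ∀ a ∈ S ∩ ball w ε, ∀ b ∈ S ∩ ball w ε, ∀ c ∈ S, a ≠ b → c ≠ a → c ≠ b →
      ¬ Wbtw ℝ a c b := fun a ha b hb c hc hab hca hcb hw => by
    refine disjoint_left.1 (h a ha b hb hab) ?_ hc
    rw [openSegment_eq_image_lineMap]
    exact (sbtw_iff_mem_image_Ioo_and_ne.1 ⟨hw, hca, hcb⟩).1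
  classical
  have hinf : (S ∩ ball w ε).Infinite := by
    have := (hS w hw).nhds_inter (ball_mem_nhds w hε)
    exact inter_comm _ S ▸ Set.Infinite.of_accPt this
  obtain ⟨t, hts, ht⟩ := hinf.exists_subset_card_eq 3
  obtain ⟨a, b, c, hab, hac, hbc, rfl⟩ := Finset.card_eq_three.1 ht
  simp only [Finset.coe_insert, Finset.coe_singleton, insert_subset_iff,
    singleton_subset_iff] at hts
  obtain ⟨ha, hb, hc⟩ := hts
  have hind : AffineIndependent ℝ ![a, b, c] := by
    rw [affineIndependent_iff_not_collinear_set]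
    intro hcol
    rcases hcol.wbtw_or_wbtw_or_wbtw with h | h | h
    · exact hsep a ha c hc b hb.1 hac hab.symm hbc h
    · exact hsep b hb a ha c hc.1 hab.symm hbc.symm hac.symm h
    · exact hsep c hc b hb a ha.1 hbc.symm hac hab h
  have htop := (hind.affineSpan_eq_top_iff_card_eq_finrank_add_one).2 (by simp [hE])
  refine top_unique (htop ▸ affineSpan_mono ℝ ?_)
  rintro _ ⟨i, rfl⟩
  fin_cases i
  exacts [ha, hb, hc]

end IsometryExtension

section Parametrization

open IntrinsicSpace IntrinsicCompletion

variable {n : ℕ} {U V : Set (EuclideanSpace ℝ (Fin n))} {hU : IsDomainSet U} {hV : IsDomainSet V}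

theorem IntrinsicCompletion.proj_mem_closure (z : IntrinsicCompletion hU) : proj z ∈ closure U := by
  obtain ⟨u, hu⟩ := exists_seq_tendsto z
  have h1 := (continuous_proj.tendsto z).comp hu
  simp only [Function.comp_def, proj_coe] at h1
  exact mem_closure_of_tendsto h1 (Eventually.of_forall fun k => (u k).val_mem)

theorem IntrinsicCompletion.proj_mem_frontier {z : IntrinsicCompletion hU}
    (hz : z ∈ boundary hU) : proj z ∈ frontier U := by
  rw [hU.1.frontier_eq]
  exact ⟨proj_mem_closure z, proj_notMem hz⟩

/-- If the Hausdorff boundary of `U` is the Euclidean one, with the Euclidean metric away from the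
point `D`, then a local isometry of Hausdorff boundaries is a parametrization of the
boundary of `V` by the frontier of `U`. -/
theorem HBoundaryLocalIsometry.exists_frontier_map {D : EuclideanSpace ℝ (Fin n)}
    (hloc : ∀ w ∈ frontier U, w ≠ D → ∃ ε > 0, ∀ z ∈ boundary hU, ∀ z' ∈ boundary hU,
      proj z ∈ ball w ε → proj z' ∈ ball w ε → dist z z' = dist (proj z) (proj z'))
    (hle : ∀ z ∈ boundary hU, ∀ z' ∈ boundary hU,
      dist z z' ≤ dist (proj z) D + dist D (proj z'))
    (hsurj : ∀ p ∈ frontier U, ∃ z ∈ boundary hU, proj z = p)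
    {f : HPoint U → HPoint V} (hf : HBoundaryLocalIsometry f) :
    ∃ F : frontier U → IntrinsicCompletion hV, Continuous F ∧ Function.Injective F ∧
      range F = boundary hV ∧ ∀ w : frontier U, w.1 ≠ D → ∃ ε > 0, ∀ a b : frontier U,
        dist a w < ε → dist b w < ε → dist (F a) (F b) = dist a b := by
  obtain ⟨g, hg, hgr, hgl⟩ := hf.exists_boundary_map hV hU
  choose s hs hps using hsurj
  let σ : frontier U → boundary hU := fun p => ⟨s p p.2, hs p p.2⟩
  have hσp : ∀ p, proj (σ p).1 = p.1 := fun p => hps p p.2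
  have hσs : Function.Surjective σ := fun z => by
    have hz := proj_mem_frontier z.2
    refine ⟨⟨proj z.1, hz⟩, ?_⟩
    set p : frontier U := ⟨proj z.1, hz⟩
    have hp : proj (σ p).1 = proj z.1 := hσp p
    refine Subtype.ext (dist_le_zero.1 ?_)
    by_cases hD : proj z.1 = D
    · refine (hle _ (σ p).2 _ z.2).trans ?_
      rw [hp, hD, dist_self, add_zero]
    · obtain ⟨ε, hε, h⟩ := hloc _ hz hD
      rw [h _ (σ p).2 _ z.2 (hp ▸ mem_ball_self hε) (mem_ball_self hε), hp, dist_self]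
  have hσi : Function.Injective σ := fun p q h => Subtype.ext (by rw [← hσp, ← hσp, h])
  have hσl : ∀ w : frontier U, w.1 ≠ D → ∃ ε > 0, ∀ a b : frontier U,
      dist a w < ε → dist b w < ε → dist (σ a) (σ b) = dist a b := fun w hw => by
    obtain ⟨ε, hε, h⟩ := hloc w w.2 hw
    refine ⟨ε, hε, fun a b ha hb => ?_⟩
    rw [Subtype.dist_eq, Subtype.dist_eq, ← hσp a, ← hσp b]
    exact h _ (σ a).2 _ (σ b).2 (by rwa [hσp]) (by rwa [hσp])
  have hσc : Continuous σ := by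
    rw [continuous_iff_continuousAt]
    intro w
    rw [Metric.continuousAt_iff]
    intro η hη
    by_cases hw : w.1 = D
    · refine ⟨η, hη, fun {p} hp => (hle _ (σ p).2 _ (σ w).2).trans_lt ?_⟩
      rw [hσp, hσp, hw, dist_self, add_zero, ← hw]
      exact hp
    · obtain ⟨ε, hε, h⟩ := hσl w hw
      refine ⟨min ε η, lt_min hε hη, fun {p} hp => ?_⟩
      rw [h p w (hp.trans_le (min_le_left _ _)) (by rwa [dist_self])]
      exact hp.trans_le (min_le_right _ _)
  have hgc : Continuous g := by
    rw [continuous_iff_continuousAt]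
    intro w
    rw [Metric.continuousAt_iff]
    intro η hη
    obtain ⟨ε, hε, h⟩ := hgl w
    refine ⟨min ε η, lt_min hε hη, fun {p} hp => ?_⟩
    rw [h p w (hp.trans_le (min_le_left _ _)) (by rwa [dist_self])]
    exact hp.trans_le (min_le_right _ _)
  refine ⟨g ∘ σ, hgc.comp hσc, hg.comp hσi, by rw [hσs.range_comp, hgr], fun w hw => ?_⟩
  obtain ⟨ε, hε, h⟩ := hσl w hw
  obtain ⟨ε', hε', h'⟩ := hgl (σ w)
  refine ⟨min ε ε', lt_min hε hε', fun a b ha hb => ?_⟩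
  have hww : dist w w < ε := by rwa [dist_self]
  have ha' := ha.trans_le (min_le_left _ _)
  have hb' := hb.trans_le (min_le_left _ _)
  rw [Function.comp, Function.comp, h' _ _ (by rw [h a w ha' hww]; exact ha.trans_le (min_le_right _ _))
    (by rw [h b w hb' hww]; exact hb.trans_le (min_le_right _ _)), h a b ha' hb']

theorem eq_of_frontier_subset {S T : Set (EuclideanSpace ℝ (Fin n))} (hS : IsOpen S) (hSc : IsPreconnected S)
    (hT : IsOpen T) (hTc : IsPreconnected T) (hST : (S ∩ T).Nonempty)
    (h : frontier T ⊆ frontier S) (h' : Disjoint T (frontier S)) : S = T := by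
  have key : ∀ {A B : Set (EuclideanSpace ℝ (Fin n))}, IsOpen B → IsPreconnected A →
      (A ∩ B).Nonempty → Disjoint A (frontier B) → A ⊆ B := fun {A B} hB hA hAB hd =>
    hA.subset_left_of_subset_union hB isClosed_closure.isOpen_compl
      (disjoint_compl_right.mono_left subset_closure) (fun x hx => by
        by_contra hcon
        simp only [mem_union, mem_compl_iff, not_or, not_not] at hcon
        exact disjoint_left.1 hd hx (hB.frontier_eq ▸ ⟨hcon.2, hcon.1⟩)) hAB
  refine Subset.antisymm (key hT hSc hST ?_) (key hS hTc (inter_comm S T ▸ hST) h')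
  exact (disjoint_frontier_iff_isOpen.2 hS).symm.mono_right h

end Parametrization

section Rigidity

open IntrinsicSpace IntrinsicCompletion

variable {n : ℕ} {V : Set (EuclideanSpace ℝ (Fin n))} {hV : IsDomainSet V}

/-- Near a point where a parametrization `F` of the Hausdorff boundary by a compact set is isometric
and the parametrizing set contains no point between two others, `proj ∘ F` is isometric and the
midpoints of its chords lie in the domain. -/
theorem exists_forall_dist_proj_eq_and_midpoint_mem {S : Set (EuclideanSpace ℝ (Fin n))}
    (hS : IsCompact S) {F : S → IntrinsicCompletion hV} (hF : Continuous F)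
    (hFi : Function.Injective F) (hFr : range F = boundary hV) {w : S} {ε : ℝ} (hε : 0 < ε)
    (hiso : ∀ a b : S, dist a w < ε → dist b w < ε → dist (F a) (F b) = dist a b)
    (hconv : ∀ a ∈ S ∩ ball w.1 ε, ∀ b ∈ S ∩ ball w.1 ε, a ≠ b →
      Disjoint (openSegment ℝ a b) S) :
    ∃ δ > 0, ∀ a b : S, dist a w < δ → dist b w < δ →
      dist (proj (F a)) (proj (F b)) = dist a b ∧
        (a ≠ b → midpoint ℝ (proj (F a)) (proj (F b)) ∈ V) := by
  have : CompactSpace S := isCompact_iff_compactSpace.1 hS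
  have hc : IsCompact (boundary hV) := hFr ▸ isCompact_range hF
  have hne : Vᶜ.Nonempty := ⟨_, proj_notMem (hFr ▸ mem_range_self w : F w ∈ boundary hV)⟩
  obtain ⟨η, hη, hηw⟩ : ∃ η > 0, ∀ p : S, dist (F p) (F w) < η → dist p w < ε := by
    have h := ball_mem_nhds w hε
    rw [(hF.isClosedEmbedding hFi).isInducing.nhds_eq_comap,
      (Metric.nhds_basis_ball.comap F).mem_iff] at h
    obtain ⟨η, hη, h⟩ := h
    exact ⟨η, hη, fun p hp => h hp⟩
  refine ⟨min ε (η / 3), by positivity, fun a b ha hb => ?_⟩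
  have hww : dist w w < ε := by rwa [dist_self]
  have haε := ha.trans_le (min_le_left _ _)
  have hbε := hb.trans_le (min_le_left _ _)
  have hbd : ∀ z ∈ boundary hV, dist (F a) z + dist z (F b) = dist (F a) (F b) →
      z = F a ∨ z = F b := by
    intro z hz h
    obtain ⟨p, rfl⟩ : z ∈ range F := hFr ▸ hz
    have hp : dist p w < ε := by
      refine hηw p ?_
      have h1 := hiso a w haε hww
      have h2 := hiso a b haε hbε
      have h3 := dist_triangle_right a b w
      have h4 := dist_triangle_left (F p) (F w) (F a)
      have h5 := ha.trans_le (min_le_right _ _)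
      have h6 := hb.trans_le (min_le_right _ _)
      have h7 := dist_nonneg (x := F p) (y := F b)
      linarith
    rw [hiso a p haε hp, hiso p b hp hbε, hiso a b haε hbε, Subtype.dist_eq, Subtype.dist_eq,
      Subtype.dist_eq, dist_add_dist_eq_iff] at h
    by_contra! hcon
    have hpa : p.1 ≠ a.1 := fun h => hcon.1 (by rw [Subtype.ext h])
    have hpb : p.1 ≠ b.1 := fun h => hcon.2 (by rw [Subtype.ext h])
    have hab : a.1 ≠ b.1 := fun hab => hpa (by rw [← hab, wbtw_self_iff] at h; exact h)
    refine disjoint_left.1 (hconv a ⟨a.2, haε⟩ b ⟨b.2, hbε⟩ hab) ?_ p.2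
    rw [openSegment_eq_image_lineMap]
    exact (sbtw_iff_mem_image_Ioo_and_ne.1 ⟨h, hpa, hpb⟩).1
  exact ⟨(dist_proj_eq hc hne hbd).trans (hiso a b haε hbε), fun hab =>
    midpoint_proj_mem hc hne hbd (hFi.ne hab)⟩

/-- A bounded plane domain, whose frontier is locally strictly convex away from a
point `D` which does not disconnect it, is determined by its Hausdorff boundary. -/
theorem HBoundaryLocalIsometry.exists_image_eq {U V : Set (EuclideanSpace ℝ (Fin 2))}
    {hU : IsDomainSet U} (hV : IsDomainSet V) (hUb : Bornology.IsBounded U)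
    {D : EuclideanSpace ℝ (Fin 2)} (hconn : IsPreconnected (frontier U \ {D}))
    (hnt : (frontier U \ {D}).Nontrivial) (hD : D ∈ closure (frontier U \ {D}))
    (hconv : ∀ w ∈ frontier U, w ≠ D → ∃ ε > 0, ∀ a ∈ frontier U ∩ ball w ε,
      ∀ b ∈ frontier U ∩ ball w ε, a ≠ b → openSegment ℝ a b ⊆ U)
    (hloc : ∀ w ∈ frontier U, w ≠ D → ∃ ε > 0, ∀ z ∈ boundary hU, ∀ z' ∈ boundary hU,
      proj z ∈ ball w ε → proj z' ∈ ball w ε → dist z z' = dist (proj z) (proj z'))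
    (hle : ∀ z ∈ boundary hU, ∀ z' ∈ boundary hU,
      dist z z' ≤ dist (proj z) D + dist D (proj z'))
    (hsurj : ∀ p ∈ frontier U, ∃ z ∈ boundary hU, proj z = p)
    {f : HPoint U → HPoint V} (hf : HBoundaryLocalIsometry f) :
    ∃ J : EuclideanSpace ℝ (Fin 2) ≃ᵃⁱ[ℝ] EuclideanSpace ℝ (Fin 2), J '' U = V := by
  obtain ⟨F, hF, hFi, hFr, hFl⟩ := hf.exists_frontier_map (hV := hV) hloc hle hsurj
  have hcomp : IsCompact (frontier U) :=
    Metric.isCompact_of_isClosed_isBounded isClosed_frontier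
      (hUb.closure.subset frontier_subset_closure)
  have hdisj : Disjoint U (frontier U) := (disjoint_frontier_iff_isOpen.2 hU.1).symm
  have hlocal : ∀ w : frontier U, w.1 ≠ D → ∃ ε > 0,
      (∀ a ∈ frontier U ∩ ball w.1 ε, ∀ b ∈ frontier U ∩ ball w.1 ε, a ≠ b →
        openSegment ℝ a b ⊆ U) ∧ ∀ a b : frontier U, dist a w < ε → dist b w < ε →
        dist (proj (F a)) (proj (F b)) = dist a b ∧
          (a ≠ b → midpoint ℝ (proj (F a)) (proj (F b)) ∈ V) := by
    intro w hw
    obtain ⟨ε₁, hε₁, h₁⟩ := hFl w hw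
    obtain ⟨ε₂, hε₂, h₂⟩ := hconv w w.2 hw
    have hsub : frontier U ∩ ball w.1 (min ε₁ ε₂) ⊆ frontier U ∩ ball w.1 ε₂ :=
      inter_subset_inter_right _ (ball_subset_ball (min_le_right _ _))
    obtain ⟨δ, hδ, h⟩ := exists_forall_dist_proj_eq_and_midpoint_mem hcomp hF hFi hFr
      (lt_min hε₁ hε₂) (fun a b ha hb => h₁ a b (ha.trans_le (min_le_left _ _))
        (hb.trans_le (min_le_left _ _)))
      fun a ha b hb hab => hdisj.mono_left (h₂ a (hsub ha) b (hsub hb) hab)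
    refine ⟨min δ ε₂, lt_min hδ hε₂, fun a ha b hb => ?_, fun a b ha hb =>
      h a b (ha.trans_le (min_le_left _ _)) (hb.trans_le (min_le_left _ _))⟩
    exact h₂ a ⟨ha.1, ball_subset_ball (min_le_right _ _) ha.2⟩
      b ⟨hb.1, ball_subset_ball (min_le_right _ _) hb.2⟩
  let q := Function.extend Subtype.val (fun p => proj (F p)) id
  have hq : ∀ p : frontier U, q p = proj (F p) := fun p =>
    Subtype.val_injective.extend_apply _ _ p
  obtain ⟨J, hJ⟩ := exists_affineIsometryEquiv_of_locally_dist_eq hconn (f := q)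
    (fun w hw ε hε => by
      obtain ⟨δ, hδ, h, -⟩ := hlocal ⟨w, hw.1⟩ hw.2
      have hle : ball w (min ε δ) ⊆ ball w δ := ball_subset_ball (min_le_right _ _)
      refine top_unique ((affineSpan_inter_ball_eq_top (by simp)
        (hconn.preperfect_of_nontrivial hnt) hw (lt_min hε hδ) ?_).ge.trans
        (affineSpan_mono ℝ (inter_subset_inter_right _ (ball_subset_ball (min_le_left _ _)))))
      exact fun a ha b hb hab => hdisj.mono (h a ⟨ha.1.1, hle ha.2⟩ b ⟨hb.1.1, hle hb.2⟩ hab)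
        sdiff_subset)
    (fun w hw => by
      obtain ⟨δ, hδ, -, h⟩ := hlocal ⟨w, hw.1⟩ hw.2
      refine ⟨δ, hδ, fun a ha b hb => ?_⟩
      have := (h ⟨a, ha.1.1⟩ ⟨b, hb.1.1⟩ ha.2 hb.2).1
      rwa [← hq, ← hq] at this)
  have hJF : ∀ p : frontier U, proj (F p) = J p := by
    have hd : Dense {p : frontier U | p.1 ≠ D} := by
      intro p
      rw [closure_subtype]
      have : Subtype.val '' {p : frontier U | p.1 ≠ D} = frontier U \ {D} := by
        ext x; simp [and_comm]
      rw [this]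
      by_cases hp : p.1 = D
      · rwa [hp]
      · exact subset_closure ⟨p.2, hp⟩
    refine congrFun (Continuous.ext_on hd (continuous_proj.comp hF)
      (J.continuous.comp continuous_subtype_val) fun p hp => ?_)
    exact (hq p).symm.trans (hJ ⟨p.2, hp⟩).symm
  have hbJ : ∀ z ∈ boundary hV, proj z ∈ J '' frontier U := fun z hz => by
    obtain ⟨p, rfl⟩ : z ∈ range F := hFr ▸ hz
    exact ⟨p, p.2, (hJF p).symm⟩
  have hJV : Disjoint V (J '' frontier U) := by
    rw [disjoint_right]
    rintro _ ⟨p, hp, rfl⟩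
    rw [← hJF ⟨p, hp⟩]
    exact proj_notMem (hFr ▸ mem_range_self _)
  obtain ⟨p, hp⟩ := hnt.nonempty
  have hne : Vᶜ.Nonempty := ⟨J p, disjoint_right.1 hJV ⟨p, hp.1, rfl⟩⟩
  have hfr : frontier V ⊆ J '' frontier U := by
    intro x hx
    have hcl : IsClosed (J '' frontier U) := (hcomp.image J.continuous).isClosed
    rw [← hcl.closure_eq, Metric.mem_closure_iff]
    intro ε hε
    obtain ⟨y, hy, hxy⟩ := Metric.mem_closure_iff.1 (frontier_subset_closure hx) (ε / 2) (half_pos hε)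
    obtain ⟨z, hz, hyz⟩ := exists_boundary_dist_le hne (IntrinsicSpace.mk hV hy)
    refine ⟨_, hbJ z hz, ?_⟩
    have h1 := dist_proj_le (IntrinsicSpace.mk hV hy : IntrinsicCompletion hV) z
    rw [proj_coe, val_mk] at h1
    have h2 : infDist y Vᶜ ≤ dist y x := by
      have := Metric.infDist_le_dist_of_mem (x := y) (s := Vᶜ) (y := x)
        (disjoint_left.1 (disjoint_frontier_iff_isOpen.2 hV.1) hx)
      exact this
    rw [val_mk] at hyz
    rw [dist_comm] at h2
    linarith [dist_triangle x y (proj z)]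
  have himg : frontier (J '' U) = J '' frontier U := (J.toHomeomorph.image_frontier U).symm
  refine ⟨J, eq_of_frontier_subset (J.toHomeomorph.isOpenMap _ hU.1)
    (hU.2.isPreconnected.image _ J.continuous.continuousOn) hV.1 hV.2.isPreconnected ?_
    (himg ▸ hfr) (himg ▸ hJV)⟩
  obtain ⟨δ, hδ, hmem, hmid⟩ := hlocal ⟨p, hp.1⟩ hp.2
  obtain ⟨r, hr, hrp⟩ := accPt_iff_nhds.1 (hconn.preperfect_of_nontrivial hnt p hp) _
    (ball_mem_nhds p hδ)
  refine ⟨_, ⟨midpoint ℝ p r, hmem p ⟨hp.1, mem_ball_self hδ⟩ r ⟨hr.2.1, hr.1⟩ hrp.symm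
    (midpoint_mem_openSegment p r), rfl⟩, ?_⟩
  have h := (hmid ⟨p, hp.1⟩ ⟨r, hr.2.1⟩ (by simpa using hδ) hr.1).2
    fun h => hrp (congrArg Subtype.val h).symm
  rw [hJF, hJF] at h
  exact (J.toAffineEquiv.map_midpoint p r).symm ▸ h

end Rigidity

section NotchedDomain

/-- The region between the parabola `y = x²` and the graph of `x ↦ 1 + |x| - x²`, the boundary
of which has a reflex corner at `(0, 1)`. -/
def notchedDomain : Set (EuclideanSpace ℝ (Fin 2)) :=
  {z | z 0 ^ 2 < z 1 ∧ z 1 < 1 + |z 0| - z 0 ^ 2}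

/-- The convex region between the parabolas `y = x²` and `y = 1 + σ x - x²`. -/
def parabolicCell (σ : ℝ) : Set (EuclideanSpace ℝ (Fin 2)) :=
  {z | z 0 ^ 2 < z 1 ∧ z 1 < 1 + σ * z 0 - z 0 ^ 2}

/-- The closure of `parabolicCell σ`. -/
def closedParabolicCell (σ : ℝ) : Set (EuclideanSpace ℝ (Fin 2)) :=
  {z | z 0 ^ 2 ≤ z 1 ∧ z 1 ≤ 1 + σ * z 0 - z 0 ^ 2}

theorem openSegment_subset_parabolicCell {σ : ℝ} {a b : EuclideanSpace ℝ (Fin 2)}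
    (ha : a ∈ closedParabolicCell σ) (hb : b ∈ closedParabolicCell σ) (hab : a ≠ b) :
    openSegment ℝ a b ⊆ parabolicCell σ := by
  rintro _ ⟨s, t, hs, ht, hst, rfl⟩
  obtain rfl : s = 1 - t := by linarith
  obtain ⟨ha₁, ha₂⟩ := ha
  obtain ⟨hb₁, hb₂⟩ := hb
  simp only [parabolicCell, mem_ofPred_eq, PiLp.add_apply, PiLp.smul_apply, smul_eq_mul]
  have hst' : 0 < (1 - t) * t := mul_pos hs ht
  by_cases hx : a 0 = b 0
  · have hy : a 1 ≠ b 1 := fun hy => hab (by ext i; fin_cases i <;> assumption)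
    rw [← hx] at hb₁ hb₂ ⊢
    rcases lt_or_gt_of_ne hy with h | h
    · have h1 := mul_lt_mul_of_pos_left h ht
      have h2 := mul_lt_mul_of_pos_left h hs
      constructor <;> nlinarith
    · have h1 := mul_lt_mul_of_pos_left h ht
      have h2 := mul_lt_mul_of_pos_left h hs
      constructor <;> nlinarith
  · have hpos : 0 < (1 - t) * t * (a 0 - b 0) ^ 2 := by
      have := sub_ne_zero.2 hx
      positivity
    have h1 := mul_le_mul_of_nonneg_left ha₁ hs.le
    have h2 := mul_le_mul_of_nonneg_left hb₁ ht.le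
    have h3 := mul_le_mul_of_nonneg_left ha₂ hs.le
    have h4 := mul_le_mul_of_nonneg_left hb₂ ht.le
    constructor <;> nlinarith

theorem parabolicCell_subset_closedParabolicCell (σ : ℝ) :
    parabolicCell σ ⊆ closedParabolicCell σ := fun _ h => ⟨h.1.le, h.2.le⟩

theorem convex_parabolicCell (σ : ℝ) : Convex ℝ (parabolicCell σ) := by
  rw [convex_iff_openSegment_subset]
  intro a ha b hb
  by_cases hab : a = b
  · rw [hab, openSegment_same]; simpa using hb
  · exact openSegment_subset_parabolicCell (parabolicCell_subset_closedParabolicCell σ ha)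
      (parabolicCell_subset_closedParabolicCell σ hb) hab

theorem center_mem_parabolicCell (σ : ℝ) : !₂[0, 1 / 2] ∈ parabolicCell σ := by
  constructor <;> norm_num

theorem closedParabolicCell_subset_closure (σ : ℝ) :
    closedParabolicCell σ ⊆ closure (parabolicCell σ) := by
  intro p hp
  have hm := center_mem_parabolicCell σ
  by_cases h : p = !₂[0, 1 / 2]
  · exact subset_closure (h ▸ hm)
  · refine closure_mono (openSegment_subset_parabolicCell hp
      (parabolicCell_subset_closedParabolicCell σ hm) h) ?_
    rw [closure_openSegment]
    exact left_mem_segment ℝ _ _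

theorem parabolicCell_subset_notchedDomain {σ : ℝ} (hσ : |σ| ≤ 1) :
    parabolicCell σ ⊆ notchedDomain := fun z ⟨h, h'⟩ =>
  ⟨h, h'.trans_le (by
    have : σ * z 0 ≤ |z 0| := (le_abs_self _).trans
      (by rw [abs_mul]; exact mul_le_of_le_one_left (abs_nonneg _) hσ)
    linarith)⟩

theorem exists_mem_closedParabolicCell {z : EuclideanSpace ℝ (Fin 2)}
    (h : z 0 ^ 2 ≤ z 1 ∧ z 1 ≤ 1 + |z 0| - z 0 ^ 2) :
    ∃ σ : ℝ, |σ| ≤ 1 ∧ z ∈ closedParabolicCell σ := by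
  rcases abs_choice (z 0) with h' | h'
  · exact ⟨1, by simp, h.1, by simpa only [h', one_mul] using h.2⟩
  · exact ⟨-1, by simp, h.1, by simpa only [h', neg_one_mul] using h.2⟩

theorem exists_mem_parabolicCell {z : EuclideanSpace ℝ (Fin 2)} (h : z ∈ notchedDomain) :
    ∃ σ : ℝ, (σ = 1 ∨ σ = -1) ∧ z ∈ parabolicCell σ := by
  rcases abs_choice (z 0) with h' | h'
  · exact ⟨1, Or.inl rfl, h.1, by simpa only [h', one_mul] using h.2⟩
  · exact ⟨-1, Or.inr rfl, h.1, by simpa only [h', neg_one_mul] using h.2⟩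

theorem isDomainSet_notchedDomain : IsDomainSet notchedDomain := by
  refine ⟨IsOpen.and (isOpen_lt (by fun_prop) (by fun_prop)) (isOpen_lt (by fun_prop) (by fun_prop)), ?_⟩
  have : notchedDomain = parabolicCell 1 ∪ parabolicCell (-1) := by
    refine Subset.antisymm (fun z hz => ?_) (union_subset
      (parabolicCell_subset_notchedDomain (by simp)) (parabolicCell_subset_notchedDomain (by simp)))
    obtain ⟨σ, rfl | rfl, h⟩ := exists_mem_parabolicCell hz
    exacts [Or.inl h, Or.inr h]
  rw [this]
  exact IsConnected.union ⟨_, center_mem_parabolicCell 1, center_mem_parabolicCell (-1)⟩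
    ((convex_parabolicCell 1).isConnected ⟨_, center_mem_parabolicCell 1⟩)
    ((convex_parabolicCell (-1)).isConnected ⟨_, center_mem_parabolicCell (-1)⟩)

theorem closure_notchedDomain :
    closure notchedDomain = {z | z 0 ^ 2 ≤ z 1 ∧ z 1 ≤ 1 + |z 0| - z 0 ^ 2} := by
  refine Subset.antisymm (closure_minimal (fun z h => ⟨h.1.le, h.2.le⟩)
    (IsClosed.and (isClosed_le (by fun_prop) (by fun_prop))
      (isClosed_le (by fun_prop) (by fun_prop)))) fun z hz => ?_
  obtain ⟨σ, hσ, h⟩ := exists_mem_closedParabolicCell hz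
  exact closure_mono (parabolicCell_subset_notchedDomain hσ)
    (closedParabolicCell_subset_closure σ h)

theorem abs_le_one_of_mem_closure_notchedDomain {z : EuclideanSpace ℝ (Fin 2)}
    (hz : z ∈ closure notchedDomain) : |z 0| ≤ 1 := by
  rw [closure_notchedDomain] at hz
  have h := hz.1.trans hz.2
  rw [← sq_abs] at h
  nlinarith [abs_nonneg (z 0)]

theorem mem_frontier_notchedDomain {z : EuclideanSpace ℝ (Fin 2)} :
    z ∈ frontier notchedDomain ↔
      |z 0| ≤ 1 ∧ (z 1 = z 0 ^ 2 ∨ z 1 = 1 + |z 0| - z 0 ^ 2) := by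
  rw [isDomainSet_notchedDomain.1.frontier_eq]
  constructor
  · rintro ⟨h, h'⟩
    refine ⟨abs_le_one_of_mem_closure_notchedDomain h, ?_⟩
    rw [closure_notchedDomain] at h
    by_contra! hcon
    exact h' ⟨lt_of_le_of_ne h.1 hcon.1.symm, lt_of_le_of_ne h.2 hcon.2⟩
  · rintro ⟨h, h'⟩
    have h0 := abs_nonneg (z 0)
    have h2 := sq_abs (z 0)
    rw [closure_notchedDomain]
    refine ⟨⟨?_, ?_⟩, fun hz => ?_⟩
    · rcases h' with h' | h' <;> nlinarith
    · rcases h' with h' | h' <;> nlinarith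
    · rcases h' with h' | h'
      · exact hz.1.ne h'.symm
      · exact hz.2.ne h'

theorem isBounded_notchedDomain : Bornology.IsBounded notchedDomain := by
  refine (Metric.isBounded_closedBall (x := (0 : EuclideanSpace ℝ (Fin 2))) (r := 3)).subset
    fun z hz => ?_
  have h := abs_le_one_of_mem_closure_notchedDomain (subset_closure hz)
  have h1 : z 1 < 2 := by nlinarith [hz.2, sq_nonneg (z 0)]
  have h2 : 0 ≤ z 1 := (sq_nonneg _).trans hz.1.le
  have h3 := abs_le.1 h
  rw [mem_closedBall_zero_iff, EuclideanSpace.norm_eq, Fin.sum_univ_two, Real.norm_eq_abs,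
    Real.norm_eq_abs, sq_abs, sq_abs]
  exact Real.sqrt_le_iff.2 ⟨by norm_num, by nlinarith⟩

theorem not_convex_notchedDomain : ¬ Convex ℝ notchedDomain := by
  intro h
  have h1 : !₂[1 / 2, 6 / 5] ∈ notchedDomain := by
    simp only [notchedDomain, mem_ofPred_eq]; norm_num [abs_of_pos]
  have h2 : !₂[-1 / 2, 6 / 5] ∈ notchedDomain := by
    simp only [notchedDomain, mem_ofPred_eq]; norm_num [abs_of_pos, abs_div]
  have h3 := h h1 h2 (by norm_num : (0 : ℝ) ≤ 1 / 2) (by norm_num : (0 : ℝ) ≤ 1 / 2) (by norm_num)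
  have h4 := h3.2
  norm_num at h4

theorem exists_ball_inter_subset_parabolicCell {w : EuclideanSpace ℝ (Fin 2)}
    (hw : w ∈ frontier notchedDomain) (hwD : w ≠ !₂[0, 1]) :
    ∃ ε > 0, ∃ σ : ℝ, |σ| ≤ 1 ∧ notchedDomain ∩ ball w ε ⊆ parabolicCell σ ∧
      closure notchedDomain ∩ ball w ε ⊆ closedParabolicCell σ := by
  have hcoord : ∀ {ε : ℝ} {z : EuclideanSpace ℝ (Fin 2)} (i : Fin 2), z ∈ ball w ε →
      |z i - w i| < ε := fun {ε z} i hz => by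
    have := PiLp.norm_apply_le (z - w) i
    rw [← dist_eq_norm] at this
    exact this.trans_lt hz
  rw [closure_notchedDomain]
  rcases lt_trichotomy (w 0) 0 with h | h | h
  · have key : ∀ z ∈ ball w (-w 0), |z 0| = -1 * z 0 := fun z hz => by
      rw [neg_one_mul]
      exact abs_of_neg (by linarith [(abs_lt.1 (hcoord 0 hz)).2])
    exact ⟨-w 0, by linarith, -1, by simp, fun z hz => ⟨hz.1.1, key z hz.2 ▸ hz.1.2⟩,
      fun z hz => ⟨hz.1.1, key z hz.2 ▸ hz.1.2⟩⟩
  · have hw1 : w 1 = 0 := by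
      rcases (mem_frontier_notchedDomain.1 hw).2 with h' | h'
      · simpa [h] using h'
      · refine absurd ?_ hwD
        ext i; fin_cases i
        · exact h
        · simpa [h] using h'
    have key : ∀ z ∈ ball w (1 / 4), z 1 < 1 + 1 * z 0 - z 0 ^ 2 := fun z hz => by
      have h0 := hcoord 0 hz
      have h1 := hcoord 1 hz
      rw [h, sub_zero, abs_lt] at h0
      rw [hw1, sub_zero, abs_lt] at h1
      nlinarith
    exact ⟨1 / 4, by norm_num, 1, by simp, fun z hz => ⟨hz.1.1, key z hz.2⟩,
      fun z hz => ⟨hz.1.1, (key z hz.2).le⟩⟩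
  · have key : ∀ z ∈ ball w (w 0), |z 0| = 1 * z 0 := fun z hz => by
      rw [one_mul]
      exact abs_of_pos (by linarith [(abs_lt.1 (hcoord 0 hz)).1])
    exact ⟨w 0, h, 1, by simp, fun z hz => ⟨hz.1.1, key z hz.2 ▸ hz.1.2⟩,
      fun z hz => ⟨hz.1.1, key z hz.2 ▸ hz.1.2⟩⟩

theorem isPreconnected_frontier_notchedDomain_diff :
    IsPreconnected (frontier notchedDomain \ {!₂[0, 1]}) := by
  let l : ℝ → EuclideanSpace ℝ (Fin 2) := fun x => !₂[x, x ^ 2]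
  let u : ℝ → EuclideanSpace ℝ (Fin 2) := fun x => !₂[x, 1 + |x| - x ^ 2]
  have hl : Continuous l := by fun_prop
  have hu : Continuous u := by fun_prop
  have h : frontier notchedDomain \ {!₂[0, 1]}
      = (l '' Icc (-1) 1 ∪ u '' Ioc 0 1) ∪ u '' Ico (-1) 0 := by
    ext z
    simp only [Set.mem_sdiff, mem_singleton_iff, mem_frontier_notchedDomain, mem_union, mem_image,
      mem_Icc, mem_Ioc, mem_Ico]
    have hz : ∀ y, z 1 = y → !₂[z 0, y] = z := by
      rintro _ rfl; ext i; fin_cases i <;> rfl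
    constructor
    · rintro ⟨⟨h, h' | h'⟩, hD⟩
      · exact Or.inl (Or.inl ⟨z 0, abs_le.1 h, hz _ h'⟩)
      · rcases lt_trichotomy (z 0) 0 with h0 | h0 | h0
        · exact Or.inr ⟨z 0, ⟨(abs_le.1 h).1, h0⟩, hz _ h'⟩
        · refine absurd ?_ hD
          rw [← hz _ h', h0]
          simp
        · exact Or.inl (Or.inr ⟨z 0, ⟨h0, (abs_le.1 h).2⟩, hz _ h'⟩)
    · have hne : ∀ {x : ℝ} {y : ℝ}, x ≠ 0 ∨ y ≠ 1 → !₂[x, y] ≠ !₂[0, 1] := fun {x y} hxy h => by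
        have h0 := congrArg (fun z : EuclideanSpace ℝ (Fin 2) => z 0) h
        have h1 := congrArg (fun z : EuclideanSpace ℝ (Fin 2) => z 1) h
        simp_all
      rintro ((⟨x, hx, rfl⟩ | ⟨x, hx, rfl⟩) | ⟨x, hx, rfl⟩)
      · refine ⟨⟨abs_le.2 hx, Or.inl rfl⟩, hne ?_⟩
        by_cases h : x = 0
        · right; simp [h]
        · exact Or.inl h
      · exact ⟨⟨abs_le.2 ⟨(by linarith : -1 ≤ x), hx.2⟩, Or.inr rfl⟩, hne (Or.inl hx.1.ne')⟩
      · exact ⟨⟨abs_le.2 ⟨hx.1, (by linarith : x ≤ 1)⟩, Or.inr rfl⟩, hne (Or.inl hx.2.ne)⟩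
  rw [h]
  refine IsPreconnected.union (l (-1)) (Or.inl ⟨-1, by norm_num, rfl⟩)
    ⟨-1, by norm_num, by simp [l, u]⟩ (IsPreconnected.union (l 1) ⟨1, by norm_num, rfl⟩
    ⟨1, by norm_num, by simp [l, u]⟩ ?_ ?_) ?_
  · exact isPreconnected_Icc.image _ hl.continuousOn
  · exact isPreconnected_Ioc.image _ hu.continuousOn
  · exact isPreconnected_Ico.image _ hu.continuousOn

theorem nontrivial_frontier_notchedDomain_diff :
    (frontier notchedDomain \ {!₂[0, 1]}).Nontrivial := by
  have hne : ∀ {a b : EuclideanSpace ℝ (Fin 2)}, a 0 ≠ b 0 → a ≠ b := fun h h' => h (h' ▸ rfl)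
  refine ⟨!₂[1, 1], ⟨mem_frontier_notchedDomain.2 (by simp), hne (by simp)⟩,
    !₂[-1, 1], ⟨mem_frontier_notchedDomain.2 (by simp), hne (by simp)⟩, hne ?_⟩
  norm_num

theorem mem_closure_frontier_notchedDomain_diff :
    !₂[0, 1] ∈ closure (frontier notchedDomain \ {!₂[0, 1]}) := by
  let u : ℝ → EuclideanSpace ℝ (Fin 2) := fun x => !₂[x, 1 + |x| - x ^ 2]
  have hu : Continuous u := by fun_prop
  have h0 : (0 : ℝ) ∈ closure (Ioo 0 1) := by
    rw [closure_Ioo zero_ne_one]; simp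
  have h1 : u 0 = !₂[0, 1] := by simp [u]
  rw [← h1]
  refine closure_mono ?_ (image_closure_subset_closure_image hu ⟨0, h0, rfl⟩)
  rintro _ ⟨x, hx, rfl⟩
  refine ⟨mem_frontier_notchedDomain.2 ⟨abs_le.2 ⟨by simp [u]; linarith [hx.1], hx.2.le⟩,
    Or.inr rfl⟩, fun h => hx.1.ne' ?_⟩
  simpa [u] using congrArg (fun z : EuclideanSpace ℝ (Fin 2) => z 0) h

theorem frontier_notchedDomain_locally_convex {w : EuclideanSpace ℝ (Fin 2)}
    (hw : w ∈ frontier notchedDomain) (hwD : w ≠ !₂[0, 1]) :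
    ∃ ε > 0, ∀ a ∈ frontier notchedDomain ∩ ball w ε, ∀ b ∈ frontier notchedDomain ∩ ball w ε,
      a ≠ b → openSegment ℝ a b ⊆ notchedDomain := by
  obtain ⟨ε, hε, σ, hσ, -, h⟩ := exists_ball_inter_subset_parabolicCell hw hwD
  exact ⟨ε, hε, fun a ha b hb hab => (openSegment_subset_parabolicCell
    (h ⟨frontier_subset_closure ha.1, ha.2⟩) (h ⟨frontier_subset_closure hb.1, hb.2⟩) hab).trans
    (parabolicCell_subset_notchedDomain hσ)⟩

open IntrinsicSpace IntrinsicCompletion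

theorem exists_dist_eq_dist_proj_notchedDomain {w : EuclideanSpace ℝ (Fin 2)}
    (hw : w ∈ frontier notchedDomain) (hwD : w ≠ !₂[0, 1]) :
    ∃ ε > 0, ∀ z z' : IntrinsicCompletion isDomainSet_notchedDomain,
      proj z ∈ ball w ε → proj z' ∈ ball w ε → dist z z' = dist (proj z) (proj z') := by
  obtain ⟨ε, hε, σ, hσ, h, -⟩ := exists_ball_inter_subset_parabolicCell hw hwD
  refine ⟨ε, hε, fun z z' hz hz' => ?_⟩
  obtain ⟨u, hu⟩ := exists_seq_tendsto z
  obtain ⟨u', hu'⟩ := exists_seq_tendsto z'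
  have hv : Tendsto (fun k => (u k).val) atTop (𝓝 (proj z)) := by
    simpa [Function.comp_def] using (continuous_proj.tendsto z).comp hu
  have hv' : Tendsto (fun k => (u' k).val) atTop (𝓝 (proj z')) := by
    simpa [Function.comp_def] using (continuous_proj.tendsto z').comp hu'
  refine tendsto_nhds_unique (hu.dist hu') ((hv.dist hv').congr' ?_)
  filter_upwards [hv.eventually_mem (isOpen_ball.mem_nhds hz),
    hv'.eventually_mem (isOpen_ball.mem_nhds hz')] with k hk hk'
  rw [UniformSpace.Completion.dist_eq]
  exact (dist_eq_of_convex (convex_parabolicCell σ) (parabolicCell_subset_notchedDomain hσ)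
    (h ⟨(u k).val_mem, hk⟩) (h ⟨(u' k).val_mem, hk'⟩)).symm

theorem dist_le_dist_proj_add_dist_proj_notchedDomain
    (z z' : IntrinsicCompletion isDomainSet_notchedDomain) :
    dist z z' ≤ dist (proj z) !₂[0, 1] + dist !₂[0, 1] (proj z') := by
  have hcell : ∀ c ∈ parabolicCell 1 ∩ parabolicCell (-1), ∀ x (hc : c ∈ notchedDomain),
      dist x (IntrinsicSpace.mk isDomainSet_notchedDomain hc) = dist x.val c := by
    intro c hc x hcU
    obtain ⟨σ, rfl | rfl, h⟩ := exists_mem_parabolicCell x.val_mem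
    · exact dist_eq_of_convex (convex_parabolicCell 1)
        (parabolicCell_subset_notchedDomain (by simp)) h hc.1
    · exact dist_eq_of_convex (convex_parabolicCell (-1))
        (parabolicCell_subset_notchedDomain (by simp)) h hc.2
  obtain ⟨u, hu⟩ := exists_seq_tendsto z
  obtain ⟨u', hu'⟩ := exists_seq_tendsto z'
  have hv : Tendsto (fun k => (u k).val) atTop (𝓝 (proj z)) := by
    simpa [Function.comp_def] using (continuous_proj.tendsto z).comp hu
  have hv' : Tendsto (fun k => (u' k).val) atTop (𝓝 (proj z')) := by
    simpa [Function.comp_def] using (continuous_proj.tendsto z').comp hu'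
  have hle : ∀ c ∈ parabolicCell 1 ∩ parabolicCell (-1),
      dist z z' ≤ dist (proj z) c + dist c (proj z') := by
    intro c hc
    have hcU : c ∈ notchedDomain := parabolicCell_subset_notchedDomain (by simp) hc.1
    refine le_of_tendsto_of_tendsto' (hu.dist hu')
      ((hv.dist tendsto_const_nhds).add (tendsto_const_nhds.dist hv')) fun k => ?_
    rw [UniformSpace.Completion.dist_eq, dist_comm c, ← hcell c hc _ hcU, ← hcell c hc _ hcU]
    exact dist_triangle_right _ _ _
  have hD : !₂[0, 1] ∈ closure (parabolicCell 1 ∩ parabolicCell (-1)) := by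
    have hmem : ∀ σ, !₂[0, 1] ∈ closedParabolicCell σ := fun σ => by
      constructor <;> norm_num
    have hne : !₂[(0 : ℝ), 1] ≠ !₂[0, 1 / 2] := fun h => by
      have := congrArg (fun z : EuclideanSpace ℝ (Fin 2) => z 1) h
      norm_num at this
    have hseg : ∀ σ, openSegment ℝ !₂[(0 : ℝ), 1] !₂[0, 1 / 2] ⊆ parabolicCell σ := fun σ =>
      openSegment_subset_parabolicCell (hmem σ)
        (parabolicCell_subset_closedParabolicCell σ (center_mem_parabolicCell σ)) hne
    refine closure_mono (subset_inter (hseg 1) (hseg (-1))) ?_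
    rw [closure_openSegment]
    exact left_mem_segment ℝ _ _
  exact closure_minimal (t := {c | dist z z' ≤ dist (proj z) c + dist c (proj z')}) hle
    (isClosed_le continuous_const (by fun_prop)) hD

theorem exists_mem_boundary_proj_eq_notchedDomain {p : EuclideanSpace ℝ (Fin 2)}
    (hp : p ∈ frontier notchedDomain) :
    ∃ z ∈ boundary isDomainSet_notchedDomain, proj z = p := by
  obtain ⟨hp₁, hp₂⟩ := isDomainSet_notchedDomain.1.frontier_eq ▸ hp
  rw [closure_notchedDomain] at hp₁
  obtain ⟨σ, hσ, h⟩ := exists_mem_closedParabolicCell hp₁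
  obtain ⟨u, hu, hup⟩ := mem_closure_iff_seq_limit.1 (closedParabolicCell_subset_closure σ h)
  have hsub := parabolicCell_subset_notchedDomain hσ
  obtain ⟨z, hz, hzp, -⟩ := exists_boundary_limit (convex_parabolicCell σ) hsub
    (u := fun k => IntrinsicSpace.mk isDomainSet_notchedDomain (hsub (hu k))) hu hp₂ hup
  exact ⟨z, hz, hzp⟩

theorem notchedDomain_uniquely_determined {V : Set (EuclideanSpace ℝ (Fin 2))} (hV : IsDomainSet V)
    {f : HPoint notchedDomain → HPoint V} (hf : HBoundaryLocalIsometry f) :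
    ∃ J : EuclideanSpace ℝ (Fin 2) ≃ᵃⁱ[ℝ] EuclideanSpace ℝ (Fin 2), J '' notchedDomain = V := by
  refine hf.exists_image_eq (hU := isDomainSet_notchedDomain) hV isBounded_notchedDomain
    isPreconnected_frontier_notchedDomain_diff nontrivial_frontier_notchedDomain_diff
    mem_closure_frontier_notchedDomain_diff
    (fun w hw hwD => frontier_notchedDomain_locally_convex hw hwD) (fun w hw hwD => ?_)
    (fun z _ z' _ => dist_le_dist_proj_add_dist_proj_notchedDomain z z')
    (fun p hp => exists_mem_boundary_proj_eq_notchedDomain hp)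
  obtain ⟨ε, hε, h⟩ := exists_dist_eq_dist_proj_notchedDomain hw hwD
  exact ⟨ε, hε, fun z _ z' _ => h z z'⟩

end NotchedDomain

section LipschitzBoundary

/-- A set which is near `x` the graph of a Lipschitz function is flattened by a shear. -/
theorem exists_lipschitz_chart_of_graph {i j : Fin 2} (hij : i ≠ j)
    {Γ W : Set (EuclideanSpace ℝ (Fin 2))} (hW : IsOpen W) {x : EuclideanSpace ℝ (Fin 2)}
    (hx : x ∈ W) {g : ℝ → ℝ} {I : Set ℝ} {K : NNReal} (hg : LipschitzOnWith K g I)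
    (hWI : ∀ z ∈ W, z i ∈ I) (hΓ : ∀ z ∈ W, z ∈ Γ ↔ z j = g (z i)) :
    ∃ (W W' : Set (EuclideanSpace ℝ (Fin 2)))
      (φ ψ : EuclideanSpace ℝ (Fin 2) → EuclideanSpace ℝ (Fin 2))
      (K K' : NNReal) (ℓ : EuclideanSpace ℝ (Fin 2) →L[ℝ] ℝ),
      IsOpen W ∧ x ∈ W ∧ IsOpen W' ∧ ℓ ≠ 0 ∧
      LipschitzOnWith K φ W ∧ LipschitzOnWith K' ψ W' ∧
      Set.MapsTo φ W W' ∧ Set.MapsTo ψ W' W ∧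
      (∀ z ∈ W, ψ (φ z) = z) ∧ (∀ z ∈ W', φ (ψ z) = z) ∧
      φ '' (W ∩ Γ) = W' ∩ {y | ℓ y = 0} := by
  obtain ⟨G, hG, hgG⟩ := hg.extend_real
  have hΓ' : ∀ z ∈ W, z ∈ Γ ↔ z j = G (z i) := fun z hz => by
    rw [hΓ z hz, hgG (hWI z hz)]
  let e : EuclideanSpace ℝ (Fin 2) := EuclideanSpace.single j 1
  have hei : e i = 0 := by simp [e, hij]
  have hej : e j = 1 := by simp [e]
  have hb : LipschitzWith K fun z : EuclideanSpace ℝ (Fin 2) => G (z i) • e := by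
    refine LipschitzWith.of_dist_le_mul fun y z => ?_
    rw [dist_eq_norm, ← sub_smul, norm_smul, show ‖e‖ = 1 by simp [e], mul_one, ← dist_eq_norm]
    refine (hG.dist_le_mul _ _).trans (mul_le_mul_of_nonneg_left ?_ K.2)
    rw [dist_eq_norm, dist_eq_norm]
    exact PiLp.norm_apply_le (y - z) i
  let φ : EuclideanSpace ℝ (Fin 2) → EuclideanSpace ℝ (Fin 2) := fun z => z - G (z i) • e
  let ψ : EuclideanSpace ℝ (Fin 2) → EuclideanSpace ℝ (Fin 2) := fun z => z + G (z i) • e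
  have hφ : LipschitzWith (1 + K) φ := LipschitzWith.id.sub hb
  have hψ : LipschitzWith (1 + K) ψ := LipschitzWith.id.add hb
  have hφi : ∀ z, φ z i = z i := fun z => by simp [φ, hei]
  have hψi : ∀ z, ψ z i = z i := fun z => by simp [ψ, hei]
  have hφj : ∀ z, φ z j = z j - G (z i) := fun z => by simp [φ, hej]
  have hψφ : ∀ z, ψ (φ z) = z := fun z => by
    simp only [ψ, hφi]; simp only [φ, sub_add_cancel]
  have hφψ : ∀ z, φ (ψ z) = z := fun z => by
    simp only [φ, hψi]; simp only [ψ, add_sub_cancel_right]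
  refine ⟨W, ψ ⁻¹' W, φ, ψ, 1 + K, 1 + K, EuclideanSpace.proj j, hW, hx,
    hW.preimage hψ.continuous, fun h => ?_, hφ.lipschitzOnWith, hψ.lipschitzOnWith,
    fun z hz => ?_, fun z hz => hz, fun z _ => hψφ z, fun z _ => hφψ z, ?_⟩
  · have := congrArg (fun ℓ => ℓ e) h
    simp [hej] at this
  · rwa [mem_preimage, hψφ]
  · ext y
    constructor
    · rintro ⟨z, ⟨hz, hzΓ⟩, rfl⟩
      refine ⟨by rwa [mem_preimage, hψφ], ?_⟩
      change φ z j = 0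
      rw [hφj, (hΓ' z hz).1 hzΓ, sub_self]
    · rintro ⟨hy, hy0⟩
      refine ⟨ψ y, ⟨hy, (hΓ' _ hy).2 ?_⟩, hφψ y⟩
      have := hφj (ψ y)
      rw [hφψ, show y j = 0 from hy0] at this
      linarith

theorem abs_sqrt_sub_sqrt_le {x y : ℝ} (hx : 1 / 16 ≤ x) (hy : 1 / 16 ≤ y) :
    |√x - √y| ≤ 2 * |x - y| := by
  have hx' : 1 / 4 ≤ √x := Real.le_sqrt_of_sq_le (by linarith)
  have hy' : 1 / 4 ≤ √y := Real.le_sqrt_of_sq_le (by linarith)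
  have h : x - y = (√x + √y) * (√x - √y) := by
    rw [← sq_sub_sq, Real.sq_sqrt (by linarith), Real.sq_sqrt (by linarith)]
  rw [h, abs_mul, abs_of_pos (by linarith : 0 < √x + √y)]
  nlinarith [abs_nonneg (√x - √y)]

/-- The boundary of `notchedDomain` near the corner `(1, 1)` is the graph of this function of the
second coordinate. -/
def cornerFun (y : ℝ) : ℝ := min (√y) (1 / 2 + √(5 / 4 - y))

theorem lipschitzOnWith_cornerFun : LipschitzOnWith 2 cornerFun (Icc (1 / 16) (19 / 16)) := by
  refine LipschitzOnWith.of_dist_le_mul fun x hx y hy => ?_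
  rw [Real.dist_eq, Real.dist_eq]
  refine (abs_min_sub_min_le_max _ _ _ _).trans (max_le (abs_sqrt_sub_sqrt_le hx.1 hy.1) ?_)
  have h := abs_sqrt_sub_sqrt_le (x := 5 / 4 - x) (y := 5 / 4 - y)
    (by linarith [hx.2]) (by linarith [hy.2])
  rw [add_sub_add_left_eq_sub]
  refine h.trans (le_of_eq ?_)
  rw [show 5 / 4 - x - (5 / 4 - y) = y - x by ring, abs_sub_comm]
  rfl

theorem eq_cornerFun_iff {x y : ℝ} (hx : 3 / 4 < x) (hy : 1 / 16 < y) (hy' : y < 19 / 16) :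
    (x ≤ 1 ∧ (y = x ^ 2 ∨ y = 1 + x - x ^ 2)) ↔ x = cornerFun y := by
  have h1 := Real.sqrt_nonneg y
  have h2 := Real.sq_sqrt (by linarith : 0 ≤ y)
  have h3 := Real.sqrt_nonneg (5 / 4 - y)
  have h4 := Real.sq_sqrt (by linarith : 0 ≤ 5 / 4 - y)
  unfold cornerFun
  constructor
  · rintro ⟨hx1, h | h⟩
    · have : √y = x := by rw [h]; exact Real.sqrt_sq (by linarith)
      rw [this, min_eq_left]
      nlinarith
    · have : √(5 / 4 - y) = x - 1 / 2 := by
        rw [show 5 / 4 - y = (x - 1 / 2) ^ 2 by rw [h]; ring]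
        exact Real.sqrt_sq (by linarith)
      rw [this, min_eq_right]
      · ring
      · nlinarith
  · intro h
    rcases min_choice (√y) (1 / 2 + √(5 / 4 - y)) with h' | h'
    · have hle := min_le_right (√y) (1 / 2 + √(5 / 4 - y))
      rw [← h] at hle h'
      rw [← h'] at h2
      refine ⟨?_, Or.inl h2.symm⟩
      nlinarith
    · have hle := min_le_left (√y) (1 / 2 + √(5 / 4 - y))
      rw [← h] at hle h'
      refine ⟨?_, Or.inr ?_⟩
      · nlinarith
      · nlinarith

theorem hasLipschitzBoundary_notchedDomain : HasLipschitzBoundary notchedDomain := by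
  intro x hx
  have hx' := mem_frontier_notchedDomain.1 hx
  rcases hx'.1.lt_or_eq with h | h
  · rcases hx'.2 with h' | h'
    · refine exists_lipschitz_chart_of_graph (i := 0) (j := 1) (by simp) (K := 2)
        (W := {z | |z 0| < 1 ∧ z 1 < (1 + |z 0|) / 2}) (g := fun t => t ^ 2) (I := Icc (-1) 1)
        (IsOpen.and (isOpen_lt (by fun_prop) (by fun_prop)) (isOpen_lt (by fun_prop) (by fun_prop)))
        ⟨h, ?_⟩ ?_ (fun z hz => abs_le.1 hz.1.le) fun z hz => ?_
      · rw [h']; nlinarith [abs_nonneg (x 0), sq_abs (x 0)]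
      · refine LipschitzOnWith.of_dist_le_mul fun s hs t ht => ?_
        rw [Real.dist_eq, Real.dist_eq, sq_sub_sq, abs_mul]
        exact mul_le_mul_of_nonneg_right
          (abs_le.2 ⟨by push_cast; linarith [hs.1, ht.1], by push_cast; linarith [hs.2, ht.2]⟩)
          (abs_nonneg _)
      · rw [mem_frontier_notchedDomain]
        refine ⟨fun hz' => hz'.2.resolve_right fun h => ?_, fun hz' => ⟨hz.1.le, Or.inl hz'⟩⟩
        nlinarith [abs_nonneg (z 0), sq_abs (z 0), hz.1, hz.2]
    · refine exists_lipschitz_chart_of_graph (i := 0) (j := 1) (by simp) (K := 3)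
        (W := {z | |z 0| < 1 ∧ (1 + |z 0|) / 2 < z 1}) (g := fun t => 1 + |t| - t ^ 2)
        (I := Icc (-1) 1)
        (IsOpen.and (isOpen_lt (by fun_prop) (by fun_prop)) (isOpen_lt (by fun_prop) (by fun_prop)))
        ⟨h, ?_⟩ ?_ (fun z hz => abs_le.1 hz.1.le) fun z hz => ?_
      · rw [h']; nlinarith [abs_nonneg (x 0), sq_abs (x 0)]
      · refine LipschitzOnWith.of_dist_le_mul fun s hs t ht => ?_
        rw [Real.dist_eq, Real.dist_eq]
        have h1 := abs_abs_sub_abs_le_abs_sub s t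
        have h2 : |t + s| * |t - s| ≤ 2 * |t - s| := mul_le_mul_of_nonneg_right
          (abs_le.2 ⟨by linarith [hs.1, ht.1], by linarith [hs.2, ht.2]⟩) (abs_nonneg _)
        rw [← abs_mul, ← sq_sub_sq, abs_sub_comm t s] at h2
        have h3 := abs_add_le (|s| - |t|) (t ^ 2 - s ^ 2)
        rw [show 1 + |s| - s ^ 2 - (1 + |t| - t ^ 2) = |s| - |t| + (t ^ 2 - s ^ 2) by ring]
        push_cast
        linarith
      · rw [mem_frontier_notchedDomain]
        refine ⟨fun hz' => hz'.2.resolve_left fun h => ?_, fun hz' => ⟨hz.1.le, Or.inr hz'⟩⟩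
        nlinarith [abs_nonneg (z 0), sq_abs (z 0), hz.1, hz.2]
  · have hx1 : x 1 = 1 := by
      rcases hx'.2 with h' | h'
      · rw [h', ← sq_abs, h, one_pow]
      · rw [h', ← sq_abs, h]; ring
    rcases eq_or_eq_neg_of_abs_eq h with h0 | h0
    · refine exists_lipschitz_chart_of_graph (i := 1) (j := 0) (by simp)
        (W := {z | 3 / 4 < z 0 ∧ 1 / 16 < z 1 ∧ z 1 < 19 / 16})
        (IsOpen.and (isOpen_lt (by fun_prop) (by fun_prop)) (IsOpen.and
          (isOpen_lt (by fun_prop) (by fun_prop)) (isOpen_lt (by fun_prop) (by fun_prop))))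
        ⟨by rw [h0]; norm_num, by rw [hx1]; norm_num, by rw [hx1]; norm_num⟩
        lipschitzOnWith_cornerFun (fun z hz => ⟨hz.2.1.le, hz.2.2.le⟩) fun z hz => ?_
      rw [mem_frontier_notchedDomain, ← eq_cornerFun_iff hz.1 hz.2.1 hz.2.2,
        abs_of_pos (by linarith [hz.1])]
    · refine exists_lipschitz_chart_of_graph (i := 1) (j := 0) (by simp)
        (W := {z | 3 / 4 < -z 0 ∧ 1 / 16 < z 1 ∧ z 1 < 19 / 16})
        (IsOpen.and (isOpen_lt (by fun_prop) (by fun_prop)) (IsOpen.and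
          (isOpen_lt (by fun_prop) (by fun_prop)) (isOpen_lt (by fun_prop) (by fun_prop))))
        ⟨by rw [h0]; norm_num, by rw [hx1]; norm_num, by rw [hx1]; norm_num⟩
        lipschitzOnWith_cornerFun.neg (fun z hz => ⟨hz.2.1.le, hz.2.2.le⟩) fun z hz => ?_
      rw [mem_frontier_notchedDomain, Pi.neg_apply, ← neg_eq_iff_eq_neg,
        ← eq_cornerFun_iff hz.1 hz.2.1 hz.2.2, neg_sq, abs_of_neg (by linarith [hz.1])]

end LipschitzBoundary

/-- there exists a bounded nonconvex plane domain with Lipschitz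
boundary which is uniquely determined in the class of all plane domains by the
condition of local isometry of the Hausdorff boundaries in the relative
metrics. -/
theorem exists_nonconvex_lipschitz_domain_uniquely_determined :
    ∃ U : Set (EuclideanSpace ℝ (Fin 2)), IsDomainSet U ∧
      Bornology.IsBounded U ∧ HasLipschitzBoundary U ∧ ¬ Convex ℝ U ∧
      ∀ V : Set (EuclideanSpace ℝ (Fin 2)), IsDomainSet V →
        (∃ f : HPoint U → HPoint V, HBoundaryLocalIsometry f) →
        ∃ J : EuclideanSpace ℝ (Fin 2) ≃ᵢ EuclideanSpace ℝ (Fin 2), J '' U = V := by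
  refine ⟨notchedDomain, isDomainSet_notchedDomain, isBounded_notchedDomain,
    hasLipschitzBoundary_notchedDomain, not_convex_notchedDomain, fun V hV ⟨f, hf⟩ => ?_⟩
  obtain ⟨J, hJ⟩ := notchedDomain_uniquely_determined hV hf
  exact ⟨J.toIsometryEquiv, hJ⟩

end
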